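/- arXiv:2401.04170 — 4 statements merged into one kernel-verified Lean document; each statement's English description precedes it below -/
import Mathlib

section
/- Fix 0 < M ≤ 1/8 and an integer ℓ ≥ 2, and let α : D → ℝ be a smooth solution of T_{+2,ℓ}. Assume the s = +2 scattering data and a priori bounds hold with constants 𝒜, ℬ, 𝒞, ε, C₀, C₁. Then for every fixed u ≤ −1: lim_{v→∞} r(u,v)^{2−ℓ}·∂_v A^{[+2],ℓ−2}(u,v) = (−1)^{ℓ+1}·( 2·(ℓ−2)!·(ℓ+1)! / (ℓ+2)! )·M·𝒜. -/
noncomputable section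
open Real Set Filter

/-- The domain `D = {(u,v) : u ≤ -1, v ≥ 1}`. -/
def D : Set (ℝ × ℝ) := {p | p.1 ≤ -1 ∧ 1 ≤ p.2}

/-- `Ω² = 1 - 2M/r`. -/
def Om2 (M : ℝ) (r : ℝ → ℝ → ℝ) (u v : ℝ) : ℝ := 1 - 2 * M / r u v

/-- `r` is the Schwarzschild area radius in double null coordinates on `D`:
smooth, `> 2M`, satisfying `r + 2M log(r/(2M)-1) = v - u` and
`∂_v r = 1 - 2M/r = -∂_u r`. -/
structure IsSchwR (M : ℝ) (r : ℝ → ℝ → ℝ) : Prop where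
  smooth : ContDiffOn ℝ (⊤ : ℕ∞) (fun p : ℝ × ℝ => r p.1 p.2) D
  gt2M : ∀ u v : ℝ, (u, v) ∈ D → 2 * M < r u v
  eqn : ∀ u v : ℝ, (u, v) ∈ D →
    r u v + 2 * M * Real.log (r u v / (2 * M) - 1) = v - u
  dv : ∀ u v : ℝ, (u, v) ∈ D →
    deriv (fun v' => r u v') v = 1 - 2 * M / r u v
  du : ∀ u v : ℝ, (u, v) ∈ D →
    deriv (fun u' => r u' v) u = -(1 - 2 * M / r u v)

/-- The base quantity `r^{|s|+s+1}·α`. -/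
def baseF (r α : ℝ → ℝ → ℝ) (s : ℤ) : ℝ → ℝ → ℝ :=
  fun u v => (r u v) ^ (|s| + s + 1) * α u v

/-- The commuted quantities `A^{[s],N} = (Ω^{-2} r² ∂_v)^N f`. -/
def AN (M : ℝ) (r f : ℝ → ℝ → ℝ) : ℕ → ℝ → ℝ → ℝ
  | 0 => f
  | N + 1 => fun u v => (r u v) ^ 2 / Om2 M r u v * deriv (fun v' => AN M r f N u v') v

/-- The fixed-angular-mode Teukolsky equation `T_{s,ℓ}` on `D`:
`∂_u(r^{-2s} Ω^{2s} ∂_v(r^{|s|+s+1} α)) = -(Ω^{2s+2}/r^{2s+2})(ℓ-s)(ℓ+s+1) r^{|s|+s+1} α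
  - (2M Ω^{2s+2}/r^{2s+3})(1+s)(1+2s) r^{|s|+s+1} α`. -/
def TeukEq (M : ℝ) (r α : ℝ → ℝ → ℝ) (s : ℤ) (ℓ : ℕ) : Prop :=
  ∀ u v : ℝ, (u, v) ∈ D →
    deriv (fun u' => (r u' v) ^ (-(2 * s)) * (Om2 M r u' v) ^ s *
        deriv (fun v' => baseF r α s u' v') v) u
      = -((Om2 M r u v) ^ (s + 1) / (r u v) ^ (2 * s + 2)) * ((ℓ : ℝ) - (s : ℝ)) *
          ((ℓ : ℝ) + (s : ℝ) + 1) * baseF r α s u v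
        - (2 * M * (Om2 M r u v) ^ (s + 1) / (r u v) ^ (2 * s + 3)) * (1 + (s : ℝ)) *
          (1 + 2 * (s : ℝ)) * baseF r α s u v

/-- The `s = +2` scattering data and a priori bounds, with constants `A, B, C, ε, C₀, C₁`:
the Post-Newtonian expansion of `α = Ψ₀`-mode along the cone `C = {v = 1}`, no incoming
radiation from past null infinity, and the a priori bounds on the commuted quantities. -/
structure PlusData (M : ℝ) (r α : ℝ → ℝ → ℝ) (ℓ : ℕ) (A B C ε C₀ C₁ : ℝ) : Prop where
  hε : 0 < ε ∧ ε < 1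
  hC₀ : 0 < C₀
  hC₁ : 0 < C₁
  data : ∀ u : ℝ, u ≤ -1 →
    |α u 1 - A * (r u 1) ^ (-3 : ℤ)
        + (1 / 6) * ((Nat.factorial (ℓ + 2) : ℝ) / (Nat.factorial (ℓ - 2) : ℝ)) * B *
          (r u 1) ^ (-4 : ℤ) * Real.log (r u 1)
        - C * (r u 1) ^ (-4 : ℤ)| ≤ C₀ * (r u 1) ^ (-4 - ε)
  noincoming : ∀ n : ℕ, 1 ≤ n → ∀ v : ℝ, 1 ≤ v →
    Tendsto (fun u => iteratedDeriv n (fun v' => r u v' * α u v') v) atBot (nhds 0)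
  apriori : ∀ N : ℕ, N ≤ ℓ - 2 → ∀ u v : ℝ, (u, v) ∈ D →
    |AN M r (baseF r α 2) N u v| ≤
      C₁ * (r u v) ^ N * (u ^ 2 + M * r u v * (Real.log (2 + r u v)) ^ 2)

namespace SchwTeuk

open scoped Topology
open Asymptotics

/-- The points of `D` off the cone `v = 1`. -/
def Dpos : Set (ℝ × ℝ) := Iic (-1) ×ˢ Ioi 1

lemma Dpos_subset : Dpos ⊆ D := fun _ hp => ⟨hp.1, le_of_lt hp.2⟩

lemma uniqueDiffOn_Dpos : UniqueDiffOn ℝ Dpos :=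
  (uniqueDiffOn_Iic _).prod (uniqueDiffOn_Ioi _)

/-- Smoothness of a function of `(u, v)` on `Dpos`. -/
def SmoothPos (F : ℝ → ℝ → ℝ) : Prop :=
  ContDiffOn ℝ (⊤ : ℕ∞) (fun p : ℝ × ℝ => F p.1 p.2) Dpos

lemma Dpos_mem_nhds {u v : ℝ} (hu : u < -1) (hv : 1 < v) : Dpos ∈ 𝓝 (u, v) :=
  prod_mem_nhds (Iic_mem_nhds hu) (Ioi_mem_nhds hv)

section Smooth

variable {F : ℝ → ℝ → ℝ}

lemma SmoothPos.hasDerivAt_fderivWithin (hF : SmoothPos F) {u v : ℝ} (hu : u ≤ -1) (hv : 1 < v) :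
    HasDerivAt (F u) (fderivWithin ℝ (fun p : ℝ × ℝ => F p.1 p.2) Dpos (u, v) (0, 1)) v := by
  have h1 := ((hF.differentiableOn (by simp)) (u, v) ⟨hu, hv⟩).hasFDerivWithinAt
  have h2 : HasDerivAt (fun v' : ℝ => (u, v')) ((0 : ℝ), (1 : ℝ)) v :=
    (hasDerivAt_const v u).prodMk (hasDerivAt_id v)
  have h3 := HasFDerivWithinAt.comp_hasDerivAt v h1 h2
    (by filter_upwards [Ioi_mem_nhds hv] with x hx using ⟨hu, hx⟩)
  exact h3

lemma SmoothPos.hasDerivAt_v (hF : SmoothPos F) {u v : ℝ} (hu : u ≤ -1) (hv : 1 < v) :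
    HasDerivAt (F u) (deriv (F u) v) v :=
  (hF.hasDerivAt_fderivWithin hu hv).differentiableAt.hasDerivAt

lemma SmoothPos.deriv_v (hF : SmoothPos F) : SmoothPos (fun u v => deriv (F u) v) := by
  have h := (hF.fderivWithin (m := (⊤ : ℕ∞)) uniqueDiffOn_Dpos (by simp)).clm_apply
    (contDiffOn_const (c := ((0 : ℝ), (1 : ℝ))))
  refine h.congr ?_
  rintro ⟨u, v⟩ ⟨hu, hv⟩
  exact (hF.hasDerivAt_fderivWithin hu hv).deriv

lemma SmoothPos.hasDerivAt_u (hF : SmoothPos F) {u v : ℝ} (hu : u < -1) (hv : 1 < v) :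
    HasDerivAt (fun u' => F u' v) (deriv (fun u' => F u' v) u) u := by
  have h1 := (ContDiffOn.contDiffAt hF (Dpos_mem_nhds hu hv)).differentiableAt (by simp)
  have h2 : DifferentiableAt ℝ (fun u' : ℝ => (u', v)) u := by fun_prop
  exact (DifferentiableAt.comp (g := fun p : ℝ × ℝ => F p.1 p.2) u h1 h2).hasDerivAt

lemma SmoothPos.contDiffAt_v (hF : SmoothPos F) {u v : ℝ} (hu : u ≤ -1) (hv : 1 < v) :
    ContDiffAt ℝ (⊤ : ℕ∞) (F u) v := by
  have h : ContDiffOn ℝ (⊤ : ℕ∞) (F u) (Ioi 1) :=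
    ContDiffOn.comp (g := fun p : ℝ × ℝ => F p.1 p.2) (f := fun v' : ℝ => (u, v')) hF
      (by fun_prop) (fun x hx => ⟨hu, hx⟩)
  exact h.contDiffAt (Ioi_mem_nhds hv)

lemma SmoothPos.continuousOn_u (hF : SmoothPos F) {v : ℝ} (hv : 1 < v) :
    ContinuousOn (fun u => F u v) (Iic (-1)) :=
  ContinuousOn.comp (g := fun p : ℝ × ℝ => F p.1 p.2) (f := fun u : ℝ => (u, v))
    hF.continuousOn (by fun_prop) (fun x hx => ⟨hx, hv⟩)

/-- Mixed partial derivatives commute: the `u`-derivative of `∂_v F` is the `v`-derivative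
of `∂_u F`. -/
lemma SmoothPos.hasDerivAt_deriv_deriv (hF : SmoothPos F) {u v : ℝ} (hu : u < -1) (hv : 1 < v) :
    HasDerivAt (fun u' => deriv (F u') v) (deriv (fun v' => deriv (fun u' => F u' v') u) v) u := by
  set f : ℝ × ℝ → ℝ := fun p => F p.1 p.2 with hf
  have hc : ContDiffAt ℝ (⊤ : ℕ∞) f (u, v) := ContDiffOn.contDiffAt hF (Dpos_mem_nhds hu hv)
  have hc2 : ContDiffAt ℝ 2 f (u, v) := 
    contDiffAt_infty.1 hc 2
  have hsym : IsSymmSndFDerivAt ℝ f (u, v) := hc2.isSymmSndFDerivAt (by simp)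
  have hdf : DifferentiableAt ℝ (fderiv ℝ f) (u, v) :=
    (hc2.fderiv_right (m := 1) (by norm_num)).differentiableAt (by simp)
  have hV : ∀ u' v' : ℝ, u' < -1 → 1 < v' → deriv (F u') v' = fderiv ℝ f (u', v') (0, 1) := by
    intro u' v' hu' hv'
    have h1 := ((ContDiffOn.contDiffAt hF (Dpos_mem_nhds hu' hv')).differentiableAt
      (by simp)).hasFDerivAt
    have h2 : HasDerivAt (fun x : ℝ => (u', x)) ((0 : ℝ), (1 : ℝ)) v' :=
      (hasDerivAt_const v' u').prodMk (hasDerivAt_id v')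
    exact (HasFDerivAt.comp_hasDerivAt v' h1 h2).deriv
  have hU : ∀ u' v' : ℝ, u' < -1 → 1 < v' →
      deriv (fun x => F x v') u' = fderiv ℝ f (u', v') (1, 0) := by
    intro u' v' hu' hv'
    have h1 := ((ContDiffOn.contDiffAt hF (Dpos_mem_nhds hu' hv')).differentiableAt
      (by simp)).hasFDerivAt
    have h2 : HasDerivAt (fun x : ℝ => (x, v')) ((1 : ℝ), (0 : ℝ)) u' :=
      (hasDerivAt_id u').prodMk (hasDerivAt_const u' v')
    exact (HasFDerivAt.comp_hasDerivAt u' h1 h2).deriv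
  have h2v : HasDerivAt (fun x : ℝ => (u, x)) ((0 : ℝ), (1 : ℝ)) v :=
    (hasDerivAt_const v u).prodMk (hasDerivAt_id v)
  have h2u : HasDerivAt (fun x : ℝ => (x, v)) ((1 : ℝ), (0 : ℝ)) u :=
    (hasDerivAt_id u).prodMk (hasDerivAt_const u v)
  have e1 : HasDerivAt (fun u' => fderiv ℝ f (u', v) (0, 1))
      (fderiv ℝ (fderiv ℝ f) (u, v) (1, 0) (0, 1)) u := by
    have h := HasFDerivAt.comp_hasDerivAt u hdf.hasFDerivAt h2u
    exact (ContinuousLinearMap.apply ℝ ℝ ((0 : ℝ), (1 : ℝ))).hasFDerivAt.comp_hasDerivAt u h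
  have e2 : HasDerivAt (fun v' => fderiv ℝ f (u, v') (1, 0))
      (fderiv ℝ (fderiv ℝ f) (u, v) (0, 1) (1, 0)) v := by
    have h := HasFDerivAt.comp_hasDerivAt v hdf.hasFDerivAt h2v
    exact (ContinuousLinearMap.apply ℝ ℝ ((1 : ℝ), (0 : ℝ))).hasFDerivAt.comp_hasDerivAt v h
  have e3 : deriv (fun v' => deriv (fun u' => F u' v') u) v
      = fderiv ℝ (fderiv ℝ f) (u, v) (1, 0) (0, 1) := by
    rw [hsym (1, 0) (0, 1), ← e2.deriv]
    refine EventuallyEq.deriv_eq ?_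
    filter_upwards [Ioi_mem_nhds hv] with x hx using hU u x hu hx
  rw [e3]
  refine e1.congr_of_eventuallyEq ?_
  filter_upwards [Iio_mem_nhds hu] with x hx using hV x v hx hv

end Smooth

section Radius

variable {M : ℝ} {r : ℝ → ℝ → ℝ}

lemma r_lower (hM : 0 < M) (hr : IsSchwR M r) {u v : ℝ} (hu : u ≤ -1) (hv : 1 ≤ v) :
    (v - u) / 2 ≤ r u v := by
  have h2 := hr.gt2M u v ⟨hu, hv⟩
  have he := hr.eqn u v ⟨hu, hv⟩
  have hy : 0 < r u v / (2 * M) - 1 := by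
    rw [sub_pos, lt_div_iff₀ (by linarith)]; linarith
  have hl := Real.log_le_sub_one_of_pos hy
  have : 2 * M * Real.log (r u v / (2 * M) - 1) ≤ 2 * M * (r u v / (2 * M) - 1 - 1) :=
    mul_le_mul_of_nonneg_left hl (by linarith)
  have e : 2 * M * (r u v / (2 * M) - 1 - 1) = r u v - 4 * M := by field_simp; ring
  linarith

lemma one_le_r (hM : 0 < M) (hr : IsSchwR M r) {u v : ℝ} (hu : u ≤ -1) (hv : 1 ≤ v) :
    1 ≤ r u v := by
  have := r_lower hM hr hu hv; linarith

lemma log_nonneg_of_r (hM : 0 < M) (hM' : M ≤ 1 / 8) (hr : IsSchwR M r) {u v : ℝ}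
    (hu : u ≤ -1) (hv : 1 ≤ v) : 0 ≤ Real.log (r u v / (2 * M) - 1) := by
  apply Real.log_nonneg
  have := one_le_r hM hr hu hv
  have : 2 ≤ r u v / (2 * M) := by rw [le_div_iff₀ (by linarith)]; linarith
  linarith

lemma r_upper (hM : 0 < M) (hM' : M ≤ 1 / 8) (hr : IsSchwR M r) {u v : ℝ}
    (hu : u ≤ -1) (hv : 1 ≤ v) : r u v ≤ v - u := by
  have := mul_nonneg (by linarith : 0 ≤ 2 * M) (log_nonneg_of_r hM hM' hr hu hv)
  have he := hr.eqn u v ⟨hu, hv⟩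
  linarith

lemma Om2_lower (hM : 0 < M) (hM' : M ≤ 1 / 8) (hr : IsSchwR M r) {u v : ℝ}
    (hu : u ≤ -1) (hv : 1 ≤ v) : 3 / 4 ≤ Om2 M r u v := by
  have h1 := one_le_r hM hr hu hv
  have : 2 * M / r u v ≤ 1 / 4 := by rw [div_le_iff₀ (by linarith)]; linarith
  unfold Om2; linarith

lemma Om2_upper (hM : 0 < M) (hr : IsSchwR M r) {u v : ℝ}
    (hu : u ≤ -1) (hv : 1 ≤ v) : Om2 M r u v ≤ 1 := by
  have h1 := one_le_r hM hr hu hv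
  have : 0 ≤ 2 * M / r u v := by positivity
  unfold Om2; linarith

lemma smoothPos_r (hr : IsSchwR M r) : SmoothPos r := hr.smooth.mono Dpos_subset

lemma hasDerivAt_r_v (hr : IsSchwR M r) {u v : ℝ} (hu : u ≤ -1) (hv : 1 < v) :
    HasDerivAt (r u) (Om2 M r u v) v := by
  have h := (smoothPos_r hr).hasDerivAt_v hu hv
  have e : deriv (r u) v = Om2 M r u v := hr.dv u v ⟨hu, hv.le⟩
  rwa [e] at h

lemma hasDerivAt_r_u (hr : IsSchwR M r) {u v : ℝ} (hu : u < -1) (hv : 1 < v) :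
    HasDerivAt (fun u' => r u' v) (-Om2 M r u v) u := by
  have h := (smoothPos_r hr).hasDerivAt_u hu hv
  have e : deriv (fun u' => r u' v) u = -Om2 M r u v := hr.du u v ⟨hu.le, hv.le⟩
  rwa [e] at h

/-- The weight `Ω²/r²`. -/
def wt (M : ℝ) (r : ℝ → ℝ → ℝ) (u v : ℝ) : ℝ := Om2 M r u v / (r u v) ^ 2

lemma wt_pos (hM : 0 < M) (hM' : M ≤ 1 / 8) (hr : IsSchwR M r) {u v : ℝ}
    (hu : u ≤ -1) (hv : 1 ≤ v) : 0 < wt M r u v := by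
  have h1 := one_le_r hM hr hu hv
  have h2 := Om2_lower hM hM' hr hu hv
  exact div_pos (by linarith) (by positivity)

lemma wt_le (hM : 0 < M) (hr : IsSchwR M r) {u v : ℝ}
    (hu : u ≤ -1) (hv : 1 ≤ v) : wt M r u v ≤ ((r u v) ^ 2)⁻¹ := by
  have h1 := one_le_r hM hr hu hv
  have h2 := Om2_upper hM hr hu hv
  rw [wt, div_eq_mul_inv]
  exact mul_le_of_le_one_left (by positivity) h2

lemma hasDerivAt_wt_u (hM : 0 < M) (hr : IsSchwR M r) {u v : ℝ} (hu : u < -1) (hv : 1 < v) :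
    HasDerivAt (fun u' => wt M r u' v)
      (wt M r u v * (2 / r u v - 6 * M / (r u v) ^ 2)) u := by
  have h := hasDerivAt_r_u hr hu hv
  have h1 : r u v ≠ 0 := by have := one_le_r hM hr hu.le hv.le; positivity
  have h2 := (((hasDerivAt_const u (2 * M)).fun_div h h1).const_sub 1).fun_div (h.fun_pow 2)
    (pow_ne_zero 2 h1)
  unfold wt Om2
  refine h2.congr_deriv ?_
  unfold Om2
  field_simp
  ring

end Radius

section Commuted

variable {M : ℝ} {r α : ℝ → ℝ → ℝ} {ℓ : ℕ}

lemma baseF_two (u v : ℝ) : baseF r α 2 u v = (r u v) ^ 5 * α u v := by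
  have : (|(2 : ℤ)| + 2 + 1) = ((5 : ℕ) : ℤ) := by norm_num
  simp only [baseF, this, zpow_natCast]

lemma smoothPos_AN (hM : 0 < M) (hM' : M ≤ 1 / 8) (hr : IsSchwR M r) {f : ℝ → ℝ → ℝ}
    (hf : SmoothPos f) (N : ℕ) : SmoothPos (AN M r f N) := by
  induction N with
  | zero => exact hf
  | succ N ih =>
    have hR : SmoothPos r := smoothPos_r hr
    have hD := ih.deriv_v
    unfold SmoothPos at *
    have h1 : ∀ p ∈ Dpos, r p.1 p.2 ≠ 0 := fun p hp => by
      have := one_le_r hM hr hp.1 (le_of_lt hp.2); positivity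
    have hO : ContDiffOn ℝ (⊤ : ℕ∞) (fun p : ℝ × ℝ => Om2 M r p.1 p.2) Dpos := by
      unfold Om2
      exact contDiffOn_const.sub (contDiffOn_const.div hR h1)
    have h2 : ∀ p ∈ Dpos, Om2 M r p.1 p.2 ≠ 0 := fun p hp => by
      have := Om2_lower hM hM' hr hp.1 (le_of_lt hp.2); linarith
    exact ((hR.pow 2).div hO h2).mul hD

lemma smoothPos_baseF (hr : IsSchwR M r)
    (hα : ContDiffOn ℝ (⊤ : ℕ∞) (fun p : ℝ × ℝ => α p.1 p.2) D) : SmoothPos (baseF r α 2) := by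
  have h1 : SmoothPos r := smoothPos_r hr
  unfold SmoothPos at *
  simp only [baseF_two]
  exact (h1.pow 5).mul (hα.mono Dpos_subset)

lemma AN_succ_eq (f : ℝ → ℝ → ℝ) (N : ℕ) (u v : ℝ) :
    AN M r f (N + 1) u v = (wt M r u v)⁻¹ * deriv (AN M r f N u) v := by
  simp only [AN, wt, inv_div]

lemma hasDerivAt_AN_v (hM : 0 < M) (hM' : M ≤ 1 / 8) (hr : IsSchwR M r) {f : ℝ → ℝ → ℝ}
    (hf : SmoothPos f) (N : ℕ) {u v : ℝ} (hu : u ≤ -1) (hv : 1 < v) :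
    HasDerivAt (AN M r f N u) (wt M r u v * AN M r f (N + 1) u v) v := by
  have h := (smoothPos_AN hM hM' hr hf N).hasDerivAt_v hu hv
  rwa [AN_succ_eq, mul_inv_cancel_left₀ (wt_pos hM hM' hr hu hv.le).ne']

/-- The coefficient of `A^N` in the commuted equation for `A^{N+1}` surviving at `M = 0`. -/
def cCoef (ℓ N : ℕ) : ℝ := (ℓ : ℝ) * (ℓ + 1) - (N + 2) * (N + 3)

/-- The coefficient of `M r⁻¹ A^N` in the commuted equation for `A^{N+1}`. -/
def dCoef (N : ℕ) : ℝ := 6 * (N : ℝ) ^ 2 + 30 * N + 30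

/-- The coefficient of `M A^{N-1}` in the commuted equation for `A^{N+1}`. -/
def eCoef (N : ℕ) : ℝ := 2 * (N : ℝ) * (N + 2) * (N + 4)

/-- The right-hand side of the commuted Teukolsky equation, without its weight. -/
def commRhs (M : ℝ) (r f : ℝ → ℝ → ℝ) (ℓ N : ℕ) (u v : ℝ) : ℝ :=
  -(cCoef ℓ N + dCoef N * (M / r u v)) * AN M r f N u v
    + eCoef N * M * AN M r f (N - 1) u v

lemma deriv_AN_u (hM : 0 < M) (hM' : M ≤ 1 / 8) (hr : IsSchwR M r)
    (hα : ContDiffOn ℝ (⊤ : ℕ∞) (fun p : ℝ × ℝ => α p.1 p.2) D) (hT : TeukEq M r α 2 ℓ) (N : ℕ) :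
    ∀ u v : ℝ, u < -1 → 1 < v →
      deriv (fun u' => AN M r (baseF r α 2) (N + 1) u' v) u
        = -((N : ℝ) + 3) * (2 / r u v - 6 * M / (r u v) ^ 2) * AN M r (baseF r α 2) (N + 1) u v
          + commRhs M r (baseF r α 2) ℓ N u v := by
  have hf := smoothPos_baseF hr hα
  induction N with
  | zero =>
    intro u v hu hv
    have hw := hasDerivAt_wt_u hM hr hu hv
    have hA := (smoothPos_AN hM hM' hr hf 1).hasDerivAt_u hu hv
    have hprod := (hw.fun_pow 3).fun_mul hA
    have hrp := one_le_r hM hr hu.le hv.le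
    have hwp := wt_pos hM hM' hr hu.le hv.le
    have key := hT u v ⟨hu.le, hv.le⟩
    have hev : (fun u' => (r u' v) ^ (-(2 * 2) : ℤ) * (Om2 M r u' v) ^ (2 : ℤ) *
        deriv (fun v' => baseF r α 2 u' v') v) =ᶠ[𝓝 u]
        (fun u' => wt M r u' v ^ 3 * AN M r (baseF r α 2) 1 u' v) := by
      filter_upwards [Iio_mem_nhds hu] with x hx
      have hx' : x ≤ -1 := le_of_lt hx
      have h1 := one_le_r hM hr hx' hv.le
      have h2 := Om2_lower hM hM' hr hx' hv.le
      rw [AN_succ_eq]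
      change _ = _ * (_ * deriv (fun v' => baseF r α 2 x v') v)
      have e : (r x v) ^ (-(2 * 2) : ℤ) = ((r x v) ^ 4)⁻¹ := by
        rw [zpow_neg]; norm_cast
      have e2 : Om2 M r x v ^ (2 : ℤ) = Om2 M r x v ^ 2 := by norm_cast
      rw [e, e2, wt]
      have : Om2 M r x v ≠ 0 := by linarith
      field_simp
    rw [hev.deriv_eq, hprod.deriv] at key
    have e3 : Om2 M r u v ^ ((2 : ℤ) + 1) = Om2 M r u v ^ 3 := by norm_cast
    have e4 : r u v ^ (2 * (2 : ℤ) + 2) = r u v ^ 6 := by norm_cast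
    have e5 : r u v ^ (2 * (2 : ℤ) + 3) = r u v ^ 7 := by norm_cast
    rw [e3, e4, e5] at key
    have e6 : Om2 M r u v ^ 3 = wt M r u v ^ 3 * r u v ^ 6 := by
      rw [wt]; field_simp
    rw [e6] at key
    apply mul_left_cancel₀ (pow_ne_zero 3 hwp.ne')
    simp only [commRhs, cCoef, dCoef, eCoef]
    have e7 : AN M r (baseF r α 2) 0 u v = baseF r α 2 u v := rfl
    simp only [Nat.zero_add] at *
    rw [e7]
    push_cast at key ⊢
    field_simp at key ⊢
    linear_combination key
  | succ N ih =>
    intro u v hu hv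
    have hw := hasDerivAt_wt_u hM hr hu hv
    have hrp := one_le_r hM hr hu.le hv.le
    have hrne : r u v ≠ 0 := by linarith
    have hwp := wt_pos hM hM' hr hu.le hv.le
    have hmix := (smoothPos_AN hM hM' hr hf (N + 1)).hasDerivAt_deriv_deriv hu hv
    have hprod := (hw.fun_inv hwp.ne').fun_mul hmix
    have hev : (fun v' => deriv (fun u' => AN M r (baseF r α 2) (N + 1) u' v') u) =ᶠ[𝓝 v]
        (fun v' => -((N : ℝ) + 3) * (2 / r u v' - 6 * M / (r u v') ^ 2) *
          AN M r (baseF r α 2) (N + 1) u v' +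
          (-(cCoef ℓ N + dCoef N * (M / r u v')) * AN M r (baseF r α 2) N u v'
            + eCoef N * M * AN M r (baseF r α 2) (N - 1) u v')) := by
      filter_upwards [Ioi_mem_nhds hv] with x hx using ih u x hu hx
    have hrv := hasDerivAt_r_v hr hu.le hv
    have hA1 := hasDerivAt_AN_v hM hM' hr hf (N + 1) hu.le hv
    have hA0 := hasDerivAt_AN_v hM hM' hr hf N hu.le hv
    have hE : HasDerivAt (fun v' => eCoef N * M * AN M r (baseF r α 2) (N - 1) u v')
        (eCoef N * M * (wt M r u v * AN M r (baseF r α 2) N u v)) v := by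
      rcases Nat.eq_zero_or_pos N with h0 | h0
      · subst h0
        simpa [eCoef] using hasDerivAt_const v (0 : ℝ)
      · have h := (hasDerivAt_AN_v hM hM' hr hf (N - 1) hu.le hv).const_mul (eCoef N * M)
        rwa [Nat.sub_add_cancel h0] at h
    have hi : HasDerivAt (fun v' => 2 / r u v' - 6 * M / (r u v') ^ 2)
        ((0 * r u v - 2 * Om2 M r u v) / r u v ^ 2 -
          (0 * r u v ^ 2 - 6 * M * ((2 : ℕ) * r u v ^ (2 - 1) * Om2 M r u v)) /
            (r u v ^ 2) ^ 2) v :=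
      ((hasDerivAt_const v 2).fun_div hrv hrne).fun_sub
        ((hasDerivAt_const v (6 * M)).fun_div (hrv.fun_pow 2) (pow_ne_zero 2 hrne))
    have hm : HasDerivAt (fun v' => -(cCoef ℓ N + dCoef N * (M / r u v')))
        (-(dCoef N * ((0 * r u v - M * Om2 M r u v) / r u v ^ 2))) v :=
      ((((hasDerivAt_const v M).fun_div hrv hrne).const_mul (dCoef N)).const_add _).fun_neg
    have hR := ((hi.const_mul (-((N : ℝ) + 3))).fun_mul hA1).fun_add ((hm.fun_mul hA0).fun_add hE)
    rw [hev.deriv_eq, hR.deriv] at hprod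
    have hfin : (fun u' => AN M r (baseF r α 2) (N + 1 + 1) u' v)
        = (fun u' => (wt M r u' v)⁻¹ * deriv (AN M r (baseF r α 2) (N + 1) u') v) := by
      funext u'; rw [AN_succ_eq]
    have hd : deriv (AN M r (baseF r α 2) (N + 1) u) v
        = wt M r u v * AN M r (baseF r α 2) (N + 1 + 1) u v := hA1.deriv
    rw [hfin, hprod.deriv, hd]
    have hO : Om2 M r u v = wt M r u v * r u v ^ 2 := by
      rw [wt]; field_simp
    rw [hO]
    simp only [commRhs, cCoef, dCoef, eCoef, Nat.add_sub_cancel]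
    generalize AN M r (baseF r α 2) (N + 1 + 1) u v = X2
    generalize AN M r (baseF r α 2) (N + 1) u v = X1
    generalize AN M r (baseF r α 2) N u v = X0
    have hwne := hwp.ne'
    push_cast
    field_simp
    ring

/-- The commuted Teukolsky equation in divergence form. -/
lemma hasDerivAt_wt_pow_mul_AN (hM : 0 < M) (hM' : M ≤ 1 / 8) (hr : IsSchwR M r)
    (hα : ContDiffOn ℝ (⊤ : ℕ∞) (fun p : ℝ × ℝ => α p.1 p.2) D) (hT : TeukEq M r α 2 ℓ) (N : ℕ)
    {u v : ℝ} (hu : u < -1) (hv : 1 < v) :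
    HasDerivAt (fun u' => wt M r u' v ^ (N + 3) * AN M r (baseF r α 2) (N + 1) u' v)
      (wt M r u v ^ (N + 3) * commRhs M r (baseF r α 2) ℓ N u v) u := by
  have hw := hasDerivAt_wt_u hM hr hu hv
  have hA := (smoothPos_AN hM hM' hr (smoothPos_baseF hr hα) (N + 1)).hasDerivAt_u hu hv
  refine ((hw.fun_pow (N + 3)).fun_mul hA).congr_deriv ?_
  rw [deriv_AN_u hM hM' hr hα hT N u v hu hv]
  simp only [show N + 3 - 1 = N + 2 from rfl]
  push_cast
  ring

end Commuted

section Growth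

variable {M : ℝ} {r : ℝ → ℝ → ℝ}

/-- For fixed `v > 1`, the first `n` derivatives in `v` are `O(|u|^k)` as `u → -∞`. -/
def BigGrowth (n k : ℕ) (c : ℝ → ℝ → ℝ) : Prop :=
  ∀ j ≤ n, ∀ v : ℝ, 1 < v → (fun u => iteratedDeriv j (c u) v) =O[atBot] (fun u => u ^ k)

/-- For fixed `v > 1`, all derivatives in `v` are `o(|u|^k)` as `u → -∞`. -/
def LittleGrowth (k : ℕ) (c : ℝ → ℝ → ℝ) : Prop :=
  ∀ j : ℕ, ∀ v : ℝ, 1 < v → (fun u => iteratedDeriv j (c u) v) =o[atBot] (fun u => u ^ k)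

variable {n k l : ℕ} {c d : ℝ → ℝ → ℝ}

lemma iteratedDeriv_congr_Dpos (h : ∀ u v : ℝ, u ≤ -1 → 1 < v → c u v = d u v) (j : ℕ) {v : ℝ}
    (hv : 1 < v) : (fun u => iteratedDeriv j (c u) v) =ᶠ[atBot]
      (fun u => iteratedDeriv j (d u) v) := by
  filter_upwards [eventually_le_atBot (-1)] with u hu
  refine EventuallyEq.iteratedDeriv_eq j ?_
  filter_upwards [Ioi_mem_nhds hv] with x hx using h u x hu hx

lemma BigGrowth.congr (hc : BigGrowth n k c) (h : ∀ u v : ℝ, u ≤ -1 → 1 < v → c u v = d u v) :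
    BigGrowth n k d :=
  fun j hj v hv => (hc j hj v hv).congr' (iteratedDeriv_congr_Dpos h j hv) EventuallyEq.rfl

lemma LittleGrowth.congr (hc : LittleGrowth k c)
    (h : ∀ u v : ℝ, u ≤ -1 → 1 < v → c u v = d u v) : LittleGrowth k d :=
  fun j v hv => (hc j v hv).congr' (iteratedDeriv_congr_Dpos h j hv) EventuallyEq.rfl

lemma iteratedDeriv_mul_Dpos (hcs : SmoothPos c) (hds : SmoothPos d) (j : ℕ) {v : ℝ}
    (hv : 1 < v) :
    (fun u => ∑ i ∈ Finset.range (j + 1),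
      (j.choose i : ℝ) * (iteratedDeriv i (c u) v * iteratedDeriv (j - i) (d u) v)) =ᶠ[atBot]
      (fun u => iteratedDeriv j (fun v' => c u v' * d u v') v) := by
  filter_upwards [eventually_le_atBot (-1)] with u hu
  rw [iteratedDeriv_fun_mul (contDiffAt_infty.1 (hcs.contDiffAt_v hu hv) j)
    (contDiffAt_infty.1 (hds.contDiffAt_v hu hv) j)]
  simp only [mul_assoc]

lemma BigGrowth.mul (hcs : SmoothPos c) (hds : SmoothPos d) (hc : BigGrowth n k c)
    (hd : BigGrowth n l d) : BigGrowth n (k + l) (fun u v => c u v * d u v) := by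
  intro j hj v hv
  refine IsBigO.congr' ?_ (iteratedDeriv_mul_Dpos hcs hds j hv) EventuallyEq.rfl
  refine IsBigO.fun_sum fun i hi => ?_
  have hi' : i ≤ j := Nat.lt_succ_iff.1 (Finset.mem_range.1 hi)
  have := ((hc i (hi'.trans hj) v hv).mul (hd (j - i) ((Nat.sub_le _ _).trans hj) v hv)).const_mul_left
    (j.choose i : ℝ)
  simpa only [pow_add] using this

lemma LittleGrowth.mul (hcs : SmoothPos c) (hds : SmoothPos d) (hc : ∀ n, BigGrowth n k c)
    (hd : LittleGrowth l d) : LittleGrowth (k + l) (fun u v => c u v * d u v) := by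
  intro j v hv
  refine IsLittleO.congr' ?_ (iteratedDeriv_mul_Dpos hcs hds j hv) EventuallyEq.rfl
  refine IsLittleO.fun_sum fun i hi => ?_
  have := ((hc i i le_rfl v hv).mul_isLittleO (hd (j - i) v hv)).const_mul_left
    (j.choose i : ℝ)
  simpa only [pow_add] using this

lemma BigGrowth.sub (hcs : SmoothPos c) (hds : SmoothPos d) (hc : BigGrowth n k c)
    (hd : BigGrowth n k d) : BigGrowth n k (fun u v => c u v - d u v) := by
  intro j hj v hv
  refine ((hc j hj v hv).sub (hd j hj v hv)).congr' ?_ EventuallyEq.rfl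
  filter_upwards [eventually_le_atBot (-1)] with u hu
  rw [iteratedDeriv_fun_sub (contDiffAt_infty.1 (hcs.contDiffAt_v hu hv) j)
    (contDiffAt_infty.1 (hds.contDiffAt_v hu hv) j)]

lemma bigGrowth_const (a : ℝ) : BigGrowth n 0 (fun _ _ => a) := by
  intro j _ v _
  simp only [iteratedDeriv_const, pow_zero]
  exact isBigO_const_const _ one_ne_zero _

lemma BigGrowth.of_deriv (h0 : BigGrowth 0 k c) (h1 : BigGrowth n k (fun u v => deriv (c u) v)) :
    BigGrowth (n + 1) k c := by
  intro j hj v hv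
  rcases j with _ | j
  · exact h0 0 le_rfl v hv
  · simp only [iteratedDeriv_succ']
    exact h1 j (Nat.le_of_succ_le_succ hj) v hv

lemma LittleGrowth.deriv (h : LittleGrowth k c) : LittleGrowth k (fun u v => deriv (c u) v) := by
  intro j v hv
  simpa only [iteratedDeriv_succ'] using h (j + 1) v hv

lemma smoothPos_const (a : ℝ) : SmoothPos (fun _ _ => a) := contDiffOn_const

lemma SmoothPos.mul (hc : SmoothPos c) (hd : SmoothPos d) :
    SmoothPos (fun u v => c u v * d u v) := ContDiffOn.mul hc hd

lemma SmoothPos.sub (hc : SmoothPos c) (hd : SmoothPos d) :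
    SmoothPos (fun u v => c u v - d u v) := ContDiffOn.sub hc hd

lemma smoothPos_inv_r (hM : 0 < M) (hr : IsSchwR M r) : SmoothPos (fun u v => (r u v)⁻¹) :=
  ContDiffOn.inv (smoothPos_r hr) fun p hp => by
    have := one_le_r hM hr hp.1 (le_of_lt hp.2); positivity

lemma Om2_eq_fun : Om2 M r = fun u v => 1 - 2 * M * (r u v)⁻¹ := rfl

lemma smoothPos_Om2 (hM : 0 < M) (hr : IsSchwR M r) : SmoothPos (Om2 M r) := by
  have := (smoothPos_const 1).sub ((smoothPos_const (2 * M)).mul (smoothPos_inv_r hM hr))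
  rwa [← Om2_eq_fun] at this

lemma smoothPos_inv_Om2 (hM : 0 < M) (hM' : M ≤ 1 / 8) (hr : IsSchwR M r) :
    SmoothPos (fun u v => (Om2 M r u v)⁻¹) :=
  ContDiffOn.inv (smoothPos_Om2 hM hr) fun p hp => by
    have := Om2_lower hM hM' hr hp.1 (le_of_lt hp.2); linarith

lemma bigGrowth_Om2_of_inv_r (hM : 0 < M) (hr : IsSchwR M r)
    (h : BigGrowth n 0 (fun u v => (r u v)⁻¹)) : BigGrowth n 0 (Om2 M r) := by
  have hs := smoothPos_inv_r hM hr
  have := (bigGrowth_const (n := n) 1).sub (smoothPos_const 1) ((smoothPos_const (2 * M)).mul hs)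
    ((bigGrowth_const (n := n) (2 * M)).mul (smoothPos_const _) hs h)
  rwa [← Om2_eq_fun] at this

lemma bigGrowth_inv_r (hM : 0 < M) (hr : IsSchwR M r) (n : ℕ) :
    BigGrowth n 0 (fun u v => (r u v)⁻¹) := by
  have h0 : BigGrowth 0 0 (fun u v => (r u v)⁻¹) := by
    intro j hj v hv
    obtain rfl : j = 0 := Nat.le_zero.1 hj
    refine IsBigO.of_bound 1 ?_
    filter_upwards [eventually_le_atBot (-1)] with u hu
    have := one_le_r hM hr hu hv.le
    simp only [iteratedDeriv_zero, pow_zero, norm_one, mul_one, norm_inv, Real.norm_eq_abs]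
    rw [abs_of_pos (by linarith)]
    exact inv_le_one_of_one_le₀ this
  have hs := smoothPos_inv_r hM hr
  induction n with
  | zero => exact h0
  | succ n ih =>
    refine h0.of_deriv ?_
    have hO := bigGrowth_Om2_of_inv_r hM hr ih
    have := ((bigGrowth_const (n := n) (-1)).mul (smoothPos_const _)
      ((hs.mul hs).mul (smoothPos_Om2 hM hr))
      ((ih.mul hs hs ih).mul (hs.mul hs) (smoothPos_Om2 hM hr) hO))
    refine BigGrowth.congr this fun u v hu hv => ?_
    have h1 := one_le_r hM hr hu hv.le
    have := ((hasDerivAt_r_v hr hu hv).fun_inv (by linarith)).deriv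
    rw [this]
    field_simp

lemma bigGrowth_Om2 (hM : 0 < M) (hr : IsSchwR M r) (n : ℕ) : BigGrowth n 0 (Om2 M r) :=
  bigGrowth_Om2_of_inv_r hM hr (bigGrowth_inv_r hM hr n)

lemma hasDerivAt_Om2_v (hM : 0 < M) (hr : IsSchwR M r) {u v : ℝ} (hu : u ≤ -1) (hv : 1 < v) :
    HasDerivAt (Om2 M r u) (2 * M * Om2 M r u v / r u v ^ 2) v := by
  have h1 := one_le_r hM hr hu hv.le
  have := ((hasDerivAt_const v (2 * M)).fun_div (hasDerivAt_r_v hr hu hv)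
    (by linarith)).const_sub 1
  refine this.congr_deriv ?_
  ring

lemma bigGrowth_inv_Om2 (hM : 0 < M) (hM' : M ≤ 1 / 8) (hr : IsSchwR M r) (n : ℕ) :
    BigGrowth n 0 (fun u v => (Om2 M r u v)⁻¹) := by
  have h0 : BigGrowth 0 0 (fun u v => (Om2 M r u v)⁻¹) := by
    intro j hj v hv
    obtain rfl : j = 0 := Nat.le_zero.1 hj
    refine IsBigO.of_bound (4 / 3) ?_
    filter_upwards [eventually_le_atBot (-1)] with u hu
    have := Om2_lower hM hM' hr hu hv.le
    simp only [iteratedDeriv_zero, pow_zero, norm_one, mul_one, norm_inv, Real.norm_eq_abs]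
    rw [abs_of_pos (by linarith), inv_le_comm₀ (by linarith) (by norm_num)]
    linarith
  have hs := smoothPos_inv_Om2 hM hM' hr
  have hx := smoothPos_inv_r hM hr
  induction n with
  | zero => exact h0
  | succ n ih =>
    refine h0.of_deriv ?_
    have hX := bigGrowth_inv_r hM hr n
    have := ((bigGrowth_const (n := n) (-(2 * M))).mul (smoothPos_const _)
      ((hx.mul hx).mul hs) ((hX.mul hx hx hX).mul (hx.mul hx) hs ih))
    refine BigGrowth.congr this fun u v hu hv => ?_
    have h1 := one_le_r hM hr hu hv.le
    have h2 := Om2_lower hM hM' hr hu hv.le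
    have h3 : Om2 M r u v ≠ 0 := by linarith
    have := ((hasDerivAt_Om2_v hM hr hu hv).fun_inv h3).deriv
    rw [this]
    field_simp

lemma bigGrowth_r (hM : 0 < M) (hM' : M ≤ 1 / 8) (hr : IsSchwR M r) (n : ℕ) :
    BigGrowth n 1 r := by
  have h0 : BigGrowth 0 1 r := by
    intro j hj v hv
    obtain rfl : j = 0 := Nat.le_zero.1 hj
    refine IsBigO.of_bound (v + 1) ?_
    filter_upwards [eventually_le_atBot (-1)] with u hu
    have h1 := one_le_r hM hr hu hv.le
    have h2 := r_upper hM hM' hr hu hv.le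
    simp only [iteratedDeriv_zero, pow_one, Real.norm_eq_abs]
    rw [abs_of_pos (by linarith), abs_of_neg (by linarith)]
    nlinarith
  rcases n with _ | n
  · exact h0
  · refine h0.of_deriv ?_
    have h1 : BigGrowth n 1 (Om2 M r) := by
      intro j hj v hv
      refine (bigGrowth_Om2 hM hr n j hj v hv).trans (IsBigO.of_bound 1 ?_)
      filter_upwards [eventually_le_atBot (-1)] with u hu
      simp only [pow_zero, norm_one, pow_one, Real.norm_eq_abs, one_mul]
      rw [abs_of_neg (by linarith)]; linarith
    exact h1.congr fun u v hu hv => (hasDerivAt_r_v hr hu hv).deriv.symm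

lemma littleGrowth_AN (hM : 0 < M) (hM' : M ≤ 1 / 8) (hr : IsSchwR M r) {f : ℝ → ℝ → ℝ}
    (hf : SmoothPos f) (h0 : LittleGrowth 4 f) (N : ℕ) :
    LittleGrowth (4 + 2 * N) (AN M r f N) := by
  induction N with
  | zero => exact h0
  | succ N ih =>
    have hR := smoothPos_r hr
    have hY := smoothPos_inv_Om2 hM hM' hr
    have hB : ∀ n, BigGrowth n (1 + 1 + 0) (fun u v => r u v * r u v * (Om2 M r u v)⁻¹) :=
      fun n => ((bigGrowth_r hM hM' hr n).mul hR hR (bigGrowth_r hM hM' hr n)).mul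
        (hR.mul hR) hY (bigGrowth_inv_Om2 hM hM' hr n)
    have := LittleGrowth.mul ((hR.mul hR).mul hY) (smoothPos_AN hM hM' hr hf N).deriv_v hB ih.deriv
    rw [show 1 + 1 + 0 + (4 + 2 * N) = 4 + 2 * (N + 1) by ring] at this
    refine this.congr fun u v _ _ => ?_
    simp only [AN]
    ring

end Growth

section Boundary

variable {M : ℝ} {r α : ℝ → ℝ → ℝ} {ℓ : ℕ} {A B C ε C₀ C₁ : ℝ}

lemma log_sq_le {x : ℝ} (hx : 1 ≤ x) : Real.log x ^ 2 ≤ 4 * x := by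
  have h1 : 0 ≤ Real.log x := Real.log_nonneg hx
  have h2 : Real.log x ≤ 2 * √x := by
    have := Real.log_le_sub_one_of_pos (Real.sqrt_pos.2 (by linarith : 0 < x))
    rw [Real.log_sqrt (by linarith)] at this
    linarith
  calc Real.log x ^ 2 ≤ (2 * √x) ^ 2 := pow_le_pow_left₀ h1 h2 2
    _ = 4 * x := by rw [mul_pow, Real.sq_sqrt (by linarith)]; norm_num

lemma abs_AN_le (hM : 0 < M) (hM' : M ≤ 1 / 8) (hr : IsSchwR M r)
    (hdata : PlusData M r α ℓ A B C ε C₀ C₁) {N : ℕ} (hN : N ≤ ℓ - 2) {u v : ℝ} (hu : u ≤ -1)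
    (hv : 1 ≤ v) : |AN M r (baseF r α 2) N u v| ≤ 6 * C₁ * r u v ^ (N + 2) := by
  refine (hdata.apriori N hN u v ⟨hu, hv⟩).trans ?_
  have h1 := one_le_r hM hr hu hv
  have h2 := r_lower hM hr hu hv
  have h3 := log_sq_le (by linarith : 1 ≤ 2 + r u v)
  have hC := hdata.hC₁
  have h4 : u ^ 2 ≤ 4 * r u v ^ 2 := by nlinarith
  have h5 : M * r u v * Real.log (2 + r u v) ^ 2 ≤ 2 * r u v ^ 2 := by
    have : M * r u v * Real.log (2 + r u v) ^ 2 ≤ 1 / 8 * r u v * (12 * r u v) := by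
      gcongr
      linarith
    nlinarith
  calc C₁ * r u v ^ N * (u ^ 2 + M * r u v * Real.log (2 + r u v) ^ 2)
      ≤ C₁ * r u v ^ N * (6 * r u v ^ 2) := by gcongr; linarith
    _ = _ := by ring

lemma tendsto_r_atBot (hM : 0 < M) (hr : IsSchwR M r) {v : ℝ} (hv : 1 ≤ v) :
    Tendsto (fun u => r u v) atBot atTop := by
  refine tendsto_atTop_mono' _ ?_ (tendsto_neg_atBot_atTop.atTop_div_const (two_pos))
  filter_upwards [eventually_le_atBot (-1)] with u hu
  have := r_lower hM hr hu hv
  linarith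

lemma littleGrowth_baseF (hM : 0 < M) (hM' : M ≤ 1 / 8) (hr : IsSchwR M r)
    (hα : ContDiffOn ℝ (⊤ : ℕ∞) (fun p : ℝ × ℝ => α p.1 p.2) D)
    (hdata : PlusData M r α ℓ A B C ε C₀ C₁) : LittleGrowth 4 (baseF r α 2) := by
  have hR := smoothPos_r hr
  have hαs : SmoothPos α := hα.mono Dpos_subset
  have hφ : LittleGrowth 0 (fun u v => r u v * α u v) := by
    intro j v hv
    simp only [pow_zero, isLittleO_one_iff]
    rcases Nat.eq_zero_or_pos j with rfl | hj
    · simp only [iteratedDeriv_zero]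
      have hlim : Tendsto (fun u => 6 * C₁ * (r u v ^ 2)⁻¹) atBot (𝓝 0) := by
        have := (((tendsto_pow_atTop two_ne_zero).comp
          (tendsto_r_atBot hM hr hv.le)).inv_tendsto_atTop).const_mul (6 * C₁)
        simpa using this
      refine squeeze_zero_norm' ?_ hlim
      filter_upwards [eventually_le_atBot (-1)] with u hu
      have h1 := one_le_r hM hr hu hv.le
      have h2 := abs_AN_le hM hM' hr hdata (Nat.zero_le _) hu hv.le
      change |baseF r α 2 u v| ≤ _ at h2
      rw [baseF_two, abs_mul, abs_of_pos (by positivity : 0 < r u v ^ 5)] at h2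
      rw [Real.norm_eq_abs, abs_mul, abs_of_pos (by linarith : 0 < r u v), ← div_eq_mul_inv,
        le_div_iff₀ (by positivity)]
      have : 0 < r u v ^ 2 := by positivity
      refine le_of_mul_le_mul_right ?_ this
      calc _ = r u v ^ 5 * |α u v| := by ring
        _ ≤ _ := by simpa using h2
    · exact hdata.noincoming j hj v hv.le
  have hR2 := hR.mul hR
  have hB : ∀ n, BigGrowth n (1 + 1 + (1 + 1)) (fun u v => r u v * r u v * (r u v * r u v)) :=
    fun n => by
      have h := bigGrowth_r hM hM' hr n
      exact (h.mul hR hR h).mul hR2 hR2 (h.mul hR hR h)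
  refine (LittleGrowth.mul (hR2.mul hR2) (hR.mul hαs) hB hφ).congr fun u v _ _ => ?_
  rw [baseF_two]
  ring

/-- No incoming radiation: the weighted commuted quantities vanish at past null infinity. -/
lemma tendsto_wt_pow_mul_AN (hM : 0 < M) (hM' : M ≤ 1 / 8) (hr : IsSchwR M r)
    (hα : ContDiffOn ℝ (⊤ : ℕ∞) (fun p : ℝ × ℝ => α p.1 p.2) D)
    (hdata : PlusData M r α ℓ A B C ε C₀ C₁) (N : ℕ) {v : ℝ} (hv : 1 < v) :
    Tendsto (fun u => wt M r u v ^ (N + 3) * AN M r (baseF r α 2) (N + 1) u v) atBot (𝓝 0) := by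
  have hA := littleGrowth_AN hM hM' hr (smoothPos_baseF hr hα)
    (littleGrowth_baseF hM hM' hr hα hdata) (N + 1) 0 v hv
  simp only [iteratedDeriv_zero] at hA
  have hw : (fun u => wt M r u v ^ (N + 3)) =O[atBot]
      (fun u => (u ^ (4 + 2 * (N + 1)))⁻¹) := by
    refine IsBigO.of_bound (4 ^ (N + 3)) ?_
    filter_upwards [eventually_le_atBot (-1)] with u hu
    have h1 := one_le_r hM hr hu hv.le
    have h2 := r_lower hM hr hu hv.le
    have h3 := wt_pos hM hM' hr hu hv.le
    have h4 : wt M r u v ≤ 4 * (u ^ 2)⁻¹ := by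
      refine (wt_le hM hr hu hv.le).trans ?_
      have h5 : 0 < u ^ 2 := by nlinarith
      rw [← div_eq_mul_inv, inv_le_comm₀ (by positivity) (by positivity), inv_div]
      nlinarith
    rw [Real.norm_of_nonneg (by positivity), norm_inv, norm_pow, Real.norm_eq_abs]
    calc wt M r u v ^ (N + 3) ≤ (4 * (u ^ 2)⁻¹) ^ (N + 3) := by gcongr
      _ = _ := by
        rw [mul_pow, inv_pow, ← sq_abs u, ← pow_mul]
        ring_nf
  have := hw.mul_isLittleO hA
  have h1 : (fun u : ℝ => (u ^ (4 + 2 * (N + 1)))⁻¹ * u ^ (4 + 2 * (N + 1))) =ᶠ[atBot]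
      fun _ => (1 : ℝ) := by
    filter_upwards [eventually_le_atBot (-1)] with u hu
    exact inv_mul_cancel₀ (pow_ne_zero _ (by linarith))
  exact (isLittleO_one_iff ℝ).1 (this.congr' EventuallyEq.rfl h1)

end Boundary

lemma abs_le_of_abs_deriv_le {F F' G G' : ℝ → ℝ} {b : ℝ} (hFc : ContinuousOn F (Iic b))
    (hGc : ContinuousOn G (Iic b)) (hF : ∀ u < b, HasDerivAt F (F' u) u)
    (hG : ∀ u < b, HasDerivAt G (G' u) u) (hle : ∀ u < b, |F' u| ≤ G' u)
    (hF0 : Tendsto F atBot (𝓝 0)) (hG0 : Tendsto G atBot (𝓝 0)) {u : ℝ} (hu : u ≤ b) :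
    |F u| ≤ G u := by
  have key : ∀ H H' : ℝ → ℝ, ContinuousOn H (Iic b) → (∀ u < b, HasDerivAt H (H' u) u) →
      (∀ u < b, 0 ≤ H' u) → Tendsto H atBot (𝓝 0) → 0 ≤ H u := by
    intro H H' hc hd hpos h0
    have hmono : MonotoneOn H (Iic b) := by
      refine monotoneOn_of_deriv_nonneg (convex_Iic b) hc ?_ ?_
      · rw [interior_Iic]
        exact fun x hx => (hd x hx).differentiableAt.differentiableWithinAt
      · rw [interior_Iic]
        intro x hx
        rw [(hd x hx).deriv]
        exact hpos x hx
    refine le_of_tendsto h0 ?_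
    filter_upwards [eventually_le_atBot u] with x hx
    exact hmono (hx.trans hu) hu hx
  have h1 := key (fun x => G x - F x) (fun x => G' x - F' x) (hGc.sub hFc)
    (fun x hx => (hG x hx).sub (hF x hx)) (fun x hx => by linarith [(abs_le.1 (hle x hx)).2])
    (by simpa using hG0.sub hF0)
  have h2 := key (fun x => G x + F x) (fun x => G' x + F' x) (hGc.add hFc)
    (fun x hx => (hG x hx).add (hF x hx)) (fun x hx => by linarith [(abs_le.1 (hle x hx)).1])
    (by simpa using hG0.add hF0)
  exact abs_le.2 ⟨by linarith, by linarith⟩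

section Estimates

variable {M : ℝ} {r α : ℝ → ℝ → ℝ} {ℓ : ℕ} {A B C ε C₀ C₁ : ℝ}

lemma hasDerivAt_inv_r_pow_u (hM : 0 < M) (hr : IsSchwR M r) (k : ℕ) {u v : ℝ} (hu : u < -1)
    (hv : 1 < v) : HasDerivAt (fun u' => (r u' v ^ k)⁻¹)
      (k * Om2 M r u v * (r u v ^ (k + 1))⁻¹) u := by
  have h1 := one_le_r hM hr hu.le hv.le
  have h0 : r u v ≠ 0 := by linarith
  rcases k with _ | k
  · simpa using hasDerivAt_const u (1 : ℝ)
  · refine (((hasDerivAt_r_u hr hu hv).fun_pow (k + 1)).fun_inv (pow_ne_zero _ h0)).congr_deriv ?_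
    push_cast
    field_simp
    ring

lemma tendsto_inv_r_pow_atBot (hM : 0 < M) (hr : IsSchwR M r) {k : ℕ} (hk : k ≠ 0) {v : ℝ}
    (hv : 1 ≤ v) : Tendsto (fun u => (r u v ^ k)⁻¹) atBot (𝓝 0) :=
  ((tendsto_pow_atTop hk).comp (tendsto_r_atBot hM hr hv)).inv_tendsto_atTop

/-- Integration from past null infinity of a bound by inverse powers of `r`. -/
lemma abs_le_inv_r_pow (hM : 0 < M) (hM' : M ≤ 1 / 8) (hr : IsSchwR M r) {F F' : ℝ → ℝ} {v : ℝ}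
    (hv : 1 < v) {k : ℕ} (hk : 1 ≤ k) {a b : ℝ} (ha : 0 ≤ a) (hb : 0 ≤ b)
    (hFc : ContinuousOn F (Iic (-1))) (hF : ∀ u < -1, HasDerivAt F (F' u) u)
    (hle : ∀ u < -1, |F' u| ≤ a * (r u v ^ (k + 1))⁻¹ + b * (r u v ^ (k + 2))⁻¹)
    (hF0 : Tendsto F atBot (𝓝 0)) {u : ℝ} (hu : u ≤ -1) :
    |F u| ≤ 2 * a * (r u v ^ k)⁻¹ + 2 * b * (r u v ^ (k + 1))⁻¹ := by
  have hrc : ContinuousOn (fun u => r u v) (Iic (-1)) := (smoothPos_r hr).continuousOn_u hv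
  have hne : ∀ x ∈ Iic (-1 : ℝ), r x v ≠ 0 := fun x hx => by
    have := one_le_r hM hr hx hv.le; linarith
  have hcont : ∀ j : ℕ, ContinuousOn (fun u => (r u v ^ j)⁻¹) (Iic (-1)) := fun j =>
    (hrc.pow j).inv₀ fun x hx => pow_ne_zero _ (hne x hx)
  refine abs_le_of_abs_deriv_le (F := F) (F' := F')
    (G := fun u => 2 * a * (r u v ^ k)⁻¹ + 2 * b * (r u v ^ (k + 1))⁻¹)
    (G' := fun u => 2 * a * (k * Om2 M r u v * (r u v ^ (k + 1))⁻¹) +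
      2 * b * ((k + 1 : ℕ) * Om2 M r u v * (r u v ^ (k + 1 + 1))⁻¹)) hFc
    ((continuousOn_const.mul (hcont k)).add (continuousOn_const.mul (hcont (k + 1)))) hF
    (fun x hx => ((hasDerivAt_inv_r_pow_u hM hr k hx hv).const_mul (2 * a)).add
      ((hasDerivAt_inv_r_pow_u hM hr (k + 1) hx hv).const_mul (2 * b)))
    (fun x hx => (hle x hx).trans ?_) hF0 ?_ hu
  · have h1 := one_le_r hM hr hx.le hv.le
    have h2 := Om2_lower hM hM' hr hx.le hv.le
    have hk' : (1 : ℝ) ≤ k := by exact_mod_cast hk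
    have h3 : 1 ≤ 2 * (k * Om2 M r x v) := by nlinarith
    have h4 : 1 ≤ 2 * ((k + 1 : ℕ) * Om2 M r x v) := by push_cast; nlinarith
    have p1 : 0 ≤ a * (r x v ^ (k + 1))⁻¹ := by positivity
    have p2 : 0 ≤ b * (r x v ^ (k + 2))⁻¹ := by positivity
    have := mul_le_mul_of_nonneg_left h3 p1
    have := mul_le_mul_of_nonneg_left h4 p2
    simp only [show k + 1 + 1 = k + 2 from rfl]
    linarith
  · have e1 := (tendsto_inv_r_pow_atBot hM hr (by lia : k ≠ 0) hv.le).const_mul (2 * a)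
    have e2 := (tendsto_inv_r_pow_atBot hM hr (by lia : k + 1 ≠ 0) hv.le).const_mul (2 * b)
    simpa using e1.add e2

lemma cCoef_top (K : ℕ) : cCoef (K + 2) K = 0 := by
  simp only [cCoef]; push_cast; ring

lemma dCoef_nonneg (N : ℕ) : 0 ≤ dCoef N := by unfold dCoef; positivity

lemma eCoef_nonneg (N : ℕ) : 0 ≤ eCoef N := by unfold eCoef; positivity

lemma eCoef_mul_abs_AN_le (hM : 0 < M) (hM' : M ≤ 1 / 8) (hr : IsSchwR M r)
    (hdata : PlusData M r α ℓ A B C ε C₀ C₁) {N : ℕ} (hN : N ≤ ℓ - 2) {u v : ℝ}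
    (hu : u ≤ -1) (hv : 1 ≤ v) :
    eCoef N * |AN M r (baseF r α 2) (N - 1) u v| ≤ eCoef N * (6 * C₁ * r u v ^ (N + 1)) := by
  rcases N with _ | N
  · simp [eCoef]
  · have := abs_AN_le hM hM' hr hdata (by lia : N ≤ ℓ - 2) hu hv
    exact mul_le_mul_of_nonneg_left (by simpa using this) (eCoef_nonneg _)

lemma wt_pow_le (hM : 0 < M) (hM' : M ≤ 1 / 8) (hr : IsSchwR M r) {u v : ℝ}
    (hu : u ≤ -1) (hv : 1 ≤ v) (n : ℕ) : wt M r u v ^ n ≤ (r u v ^ (2 * n))⁻¹ := by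
  have := pow_le_pow_left₀ (wt_pos hM hM' hr hu hv).le (wt_le hM hr hu hv) n
  rwa [inv_pow, ← pow_mul] at this

lemma exists_abs_wt_pow_mul_AN_top_le (hM : 0 < M) (hM' : M ≤ 1 / 8) (hr : IsSchwR M r) {K : ℕ}
    (hα : ContDiffOn ℝ (⊤ : ℕ∞) (fun p : ℝ × ℝ => α p.1 p.2) D)
    (hT : TeukEq M r α 2 (K + 2)) (hdata : PlusData M r α (K + 2) A B C ε C₀ C₁) :
    ∃ c : ℝ, 0 ≤ c ∧ ∀ u v : ℝ, u ≤ -1 → 1 < v →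
      |wt M r u v ^ (K + 3) * AN M r (baseF r α 2) (K + 1) u v| ≤ c * (r u v ^ (K + 4))⁻¹ := by
  have hC := hdata.hC₁
  have hd := dCoef_nonneg K
  have he := eCoef_nonneg K
  refine ⟨2 * ((dCoef K + eCoef K) * M * (6 * C₁)), by positivity, fun u v hu hv => ?_⟩
  have hwc : ContinuousOn (fun u => wt M r u v) (Iic (-1)) := by
    have h1 := (smoothPos_Om2 hM hr).continuousOn_u hv
    have h2 := (smoothPos_r hr).continuousOn_u hv
    exact h1.div (h2.pow 2) fun x hx => by have := one_le_r hM hr hx hv.le; positivity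
  have hAc := (smoothPos_AN hM hM' hr (smoothPos_baseF hr hα) (K + 1)).continuousOn_u hv
  have := abs_le_inv_r_pow hM hM' hr (k := K + 4) hv (by lia)
    (by positivity : 0 ≤ (dCoef K + eCoef K) * M * (6 * C₁)) le_rfl ((hwc.pow (K + 3)).mul hAc)
    (fun x hx => hasDerivAt_wt_pow_mul_AN hM hM' hr hα hT K hx hv)
    (fun x hx => ?_) (tendsto_wt_pow_mul_AN hM hM' hr hα hdata K hv) hu
  · simpa using this
  have h1 := one_le_r hM hr hx.le hv.le
  have hA := abs_AN_le hM hM' hr hdata (by lia : K ≤ K + 2 - 2) hx.le hv.le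
  have hA' := eCoef_mul_abs_AN_le hM hM' hr hdata (by lia : K ≤ K + 2 - 2) hx.le hv.le
  have hw := wt_pow_le hM hM' hr hx.le hv.le (K + 3)
  have hwp := wt_pos hM hM' hr hx.le hv.le
  have hR : |commRhs M r (baseF r α 2) (K + 2) K x v| ≤
      (dCoef K + eCoef K) * M * (6 * C₁) * r x v ^ (K + 1) := by
    unfold commRhs
    rw [cCoef_top, zero_add]
    refine (abs_add_le _ _).trans ?_
    rw [abs_mul, abs_neg, abs_mul, abs_mul, abs_mul, abs_of_nonneg hd, abs_of_nonneg he,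
      abs_of_pos hM, abs_of_pos (by positivity : 0 < M / r x v)]
    have e1 : dCoef K * (M / r x v) * |AN M r (baseF r α 2) K x v| ≤
        dCoef K * (M / r x v) * (6 * C₁ * r x v ^ (K + 2)) := by gcongr
    have e2 : dCoef K * (M / r x v) * (6 * C₁ * r x v ^ (K + 2)) =
        dCoef K * M * (6 * C₁) * r x v ^ (K + 1) := by field_simp; ring
    have e3 := mul_le_mul_of_nonneg_left hA' hM.le
    linarith
  rw [abs_mul, abs_of_pos (pow_pos hwp _), zero_mul, add_zero]
  calc _ ≤ (r x v ^ (2 * (K + 3)))⁻¹ *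
        ((dCoef K + eCoef K) * M * (6 * C₁) * r x v ^ (K + 1)) := by gcongr
    _ = _ := by field_simp; ring

lemma exists_abs_wt_mul_AN_top_le (hM : 0 < M) (hM' : M ≤ 1 / 8) (hr : IsSchwR M r) {K : ℕ}
    (hα : ContDiffOn ℝ (⊤ : ℕ∞) (fun p : ℝ × ℝ => α p.1 p.2) D)
    (hT : TeukEq M r α 2 (K + 2)) (hdata : PlusData M r α (K + 2) A B C ε C₀ C₁) :
    ∃ c : ℝ, 0 ≤ c ∧ ∀ u v : ℝ, u ≤ -1 → 1 < v →
      |wt M r u v * AN M r (baseF r α 2) (K + 1) u v| ≤ c * r u v ^ K := by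
  obtain ⟨c, hc, h⟩ := exists_abs_wt_pow_mul_AN_top_le hM hM' hr hα hT hdata
  refine ⟨(4 / 3) ^ (K + 2) * c, by positivity, fun u v hu hv => ?_⟩
  have h1 := one_le_r hM hr hu hv.le
  have hO := Om2_lower hM hM' hr hu hv.le
  have hwp := wt_pos hM hM' hr hu hv.le
  have hw : (wt M r u v)⁻¹ ≤ 4 / 3 * r u v ^ 2 := by
    rw [wt, inv_div, div_le_iff₀ (by linarith)]
    nlinarith [sq_nonneg (r u v)]
  have e : wt M r u v * AN M r (baseF r α 2) (K + 1) u v =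
      (wt M r u v)⁻¹ ^ (K + 2) * (wt M r u v ^ (K + 3) * AN M r (baseF r α 2) (K + 1) u v) := by
    rw [inv_pow, eq_inv_mul_iff_mul_eq₀ (pow_ne_zero _ hwp.ne')]
    ring
  rw [e, abs_mul, abs_of_pos (by positivity)]
  calc _ ≤ (4 / 3 * r u v ^ 2) ^ (K + 2) * (c * (r u v ^ (K + 4))⁻¹) := by
        have := h u v hu hv
        gcongr
    _ = _ := by field_simp; ring

lemma exists_abs_wt_mul_AN_one_le (hM : 0 < M) (hM' : M ≤ 1 / 8) (hr : IsSchwR M r) {K : ℕ}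
    (hα : ContDiffOn ℝ (⊤ : ℕ∞) (fun p : ℝ × ℝ => α p.1 p.2) D)
    (hT : TeukEq M r α 2 (K + 2)) (hdata : PlusData M r α (K + 2) A B C ε C₀ C₁) :
    ∃ c : ℝ, 0 ≤ c ∧ ∀ u v : ℝ, u ≤ -1 → 1 < v →
      |wt M r u v * AN M r (baseF r α 2) 1 u v| ≤ c * r u v := by
  rcases K with _ | K
  · obtain ⟨c, hc, h⟩ := exists_abs_wt_mul_AN_top_le hM hM' hr hα hT hdata
    refine ⟨c, hc, fun u v hu hv => (h u v hu hv).trans ?_⟩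
    have h1 := one_le_r hM hr hu hv.le
    gcongr
    simpa using h1
  · have hC := hdata.hC₁
    refine ⟨6 * C₁, by positivity, fun u v hu hv => ?_⟩
    have h1 := one_le_r hM hr hu hv.le
    have hwp := wt_pos hM hM' hr hu hv.le
    have hw := wt_le hM hr hu hv.le
    have hA := abs_AN_le hM hM' hr hdata (by lia : 1 ≤ K + 1 + 2 - 2) hu hv.le
    rw [abs_mul, abs_of_pos hwp]
    calc _ ≤ (r u v ^ 2)⁻¹ * (6 * C₁ * r u v ^ (1 + 2)) := by gcongr
      _ = _ := by field_simp

end Estimates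

section InitialData

variable {M : ℝ} {r α : ℝ → ℝ → ℝ} {ℓ : ℕ} {A B C ε C₀ C₁ : ℝ}

lemma tendsto_log_div_self : Tendsto (fun x : ℝ => Real.log x / x) atTop (𝓝 0) :=
  Real.isLittleO_log_id_atTop.tendsto_div_nhds_zero

lemma tendsto_r_div_neg (hM : 0 < M) (hM' : M ≤ 1 / 8) (hr : IsSchwR M r) {v : ℝ} (hv : 1 ≤ v) :
    Tendsto (fun u => r u v / (-u)) atBot (𝓝 1) := by
  have hrt := tendsto_r_atBot hM hr hv
  have hinv : Tendsto (fun u => (r u v)⁻¹) atBot (𝓝 0) := hrt.inv_tendsto_atTop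
  have hlog : Tendsto (fun u => Real.log (r u v / (2 * M) - 1) / r u v) atBot (𝓝 0) := by
    have hup : Tendsto (fun u => Real.log (r u v) / r u v - Real.log (2 * M) * (r u v)⁻¹)
        atBot (𝓝 0) := by
      simpa using (tendsto_log_div_self.comp hrt).sub (hinv.const_mul (Real.log (2 * M)))
    refine tendsto_of_tendsto_of_tendsto_of_le_of_le' tendsto_const_nhds hup ?_ ?_
    · filter_upwards [eventually_le_atBot (-1)] with u hu
      have h1 := one_le_r hM hr hu hv
      exact div_nonneg (log_nonneg_of_r hM hM' hr hu hv) (by linarith)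
    · filter_upwards [eventually_le_atBot (-1)] with u hu
      have h1 := one_le_r hM hr hu hv
      have h2 : 2 ≤ r u v / (2 * M) := by rw [le_div_iff₀ (by linarith)]; linarith
      have h3 : Real.log (r u v / (2 * M) - 1) ≤ Real.log (r u v) - Real.log (2 * M) := by
        rw [← Real.log_div (by linarith) (by linarith)]
        exact Real.log_le_log (by linarith) (by linarith)
      rw [← div_eq_mul_inv, ← sub_div]
      gcongr
  have hq : Tendsto (fun u => (-u) / r u v) atBot (𝓝 1) := by
    have : Tendsto (fun u => 1 + 2 * M * (Real.log (r u v / (2 * M) - 1) / r u v) - v * (r u v)⁻¹)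
        atBot (𝓝 1) := by
      simpa using ((hlog.const_mul (2 * M)).const_add 1).sub (hinv.const_mul v)
    refine this.congr' ?_
    filter_upwards [eventually_le_atBot (-1)] with u hu
    have h1 := one_le_r hM hr hu hv
    have he := hr.eqn u v ⟨hu, hv⟩
    generalize Real.log (r u v / (2 * M) - 1) = L at he ⊢
    field_simp
    linarith
  simpa using hq.inv₀ one_ne_zero

lemma tendsto_baseF_cone (hM : 0 < M) (hM' : M ≤ 1 / 8) (hr : IsSchwR M r)
    (hdata : PlusData M r α ℓ A B C ε C₀ C₁) :
    Tendsto (fun u => baseF r α 2 u 1 / (-u) ^ 2) atBot (𝓝 A) := by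
  have hrt := tendsto_r_atBot hM hr le_rfl
  have hinv : Tendsto (fun u => (r u 1)⁻¹) atBot (𝓝 0) := hrt.inv_tendsto_atTop
  set κ : ℝ := (1 / 6) * ((Nat.factorial (ℓ + 2) : ℝ) / (Nat.factorial (ℓ - 2) : ℝ)) * B with hκ
  have hmain : Tendsto (fun u => A - κ * (Real.log (r u 1) / r u 1) + C * (r u 1)⁻¹)
      atBot (𝓝 A) := by
    simpa using (((tendsto_log_div_self.comp hrt).const_mul κ).const_sub A).add (hinv.const_mul C)
  have herr : Tendsto (fun u => r u 1 ^ 3 * α u 1 -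
      (A - κ * (Real.log (r u 1) / r u 1) + C * (r u 1)⁻¹)) atBot (𝓝 0) := by
    refine squeeze_zero_norm' (a := fun u => C₀ * (r u 1)⁻¹) ?_ (by simpa using hinv.const_mul C₀)
    filter_upwards [eventually_le_atBot (-1)] with u hu
    have h1 := one_le_r hM hr hu le_rfl
    have h2 := hdata.data u hu
    have h3 : r u 1 ^ (-4 - ε) ≤ (r u 1 ^ 4)⁻¹ := by
      have := Real.rpow_le_rpow_of_exponent_le h1 (by linarith [hdata.hε.1] : -4 - ε ≤ -4)
      rwa [Real.rpow_neg (by linarith), show (4 : ℝ) = (4 : ℕ) by norm_num,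
        Real.rpow_natCast] at this
    have e3 : r u 1 ^ (-3 : ℤ) = (r u 1 ^ 3)⁻¹ := by rw [zpow_neg]; norm_cast
    have e4 : r u 1 ^ (-4 : ℤ) = (r u 1 ^ 4)⁻¹ := by rw [zpow_neg]; norm_cast
    rw [e3, e4] at h2
    have h4 := h2.trans (mul_le_mul_of_nonneg_left h3 hdata.hC₀.le)
    have h5 := mul_le_mul_of_nonneg_left h4 (by positivity : 0 ≤ r u 1 ^ 3)
    rw [Real.norm_eq_abs]
    have p3 : 0 < r u 1 ^ 3 := by positivity
    rw [← abs_of_pos p3, ← abs_mul, abs_of_pos p3] at h5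
    refine le_trans (le_of_eq (congrArg _ ?_)) (h5.trans (le_of_eq ?_))
    · rw [hκ]
      field_simp
      ring
    · field_simp
  have h := ((herr.add hmain).mul ((tendsto_r_div_neg hM hM' hr le_rfl).pow 2))
  simp only [zero_add, one_pow, mul_one] at h
  refine h.congr' ?_
  filter_upwards [eventually_le_atBot (-1)] with u hu
  rw [baseF_two, div_pow]
  ring

lemma tendsto_AN_zero_two (hM : 0 < M) (hM' : M ≤ 1 / 8) (hr : IsSchwR M r) {K : ℕ}
    (hα : ContDiffOn ℝ (⊤ : ℕ∞) (fun p : ℝ × ℝ => α p.1 p.2) D)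
    (hT : TeukEq M r α 2 (K + 2)) (hdata : PlusData M r α (K + 2) A B C ε C₀ C₁) :
    Tendsto (fun u => AN M r (baseF r α 2) 0 u 2 / (-u) ^ 2) atBot (𝓝 A) := by
  obtain ⟨c, hc, h⟩ := exists_abs_wt_mul_AN_one_le hM hM' hr hα hT hdata
  have hf := smoothPos_baseF hr hα
  have hcone := tendsto_baseF_cone hM hM' hr hdata
  have herr : Tendsto (fun u => (baseF r α 2 u 2 - baseF r α 2 u 1) / (-u) ^ 2) atBot (𝓝 0) := by
    have hlim : Tendsto (fun u : ℝ => 3 * c * (-u)⁻¹) atBot (𝓝 0) := by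
      simpa using (tendsto_neg_atBot_atTop.inv_tendsto_atTop).const_mul (3 * c)
    refine squeeze_zero_norm' ?_ hlim
    filter_upwards [eventually_le_atBot (-1)] with u hu
    have hcont : ContinuousOn (baseF r α 2 u) (Icc 1 2) := by
      have hmap : ∀ g : ℝ → ℝ → ℝ, ContDiffOn ℝ (⊤ : ℕ∞) (fun p : ℝ × ℝ => g p.1 p.2) D →
          ContinuousOn (g u) (Icc 1 2) := fun g hg =>
        ContinuousOn.comp (g := fun p : ℝ × ℝ => g p.1 p.2) (f := fun v' : ℝ => (u, v'))
          hg.continuousOn (by fun_prop) (fun x hx => ⟨hu, hx.1⟩)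
      have : baseF r α 2 u = fun v => r u v ^ 5 * α u v := by funext v; exact baseF_two u v
      rw [this]
      exact ((hmap r hr.smooth).pow 5).mul (hmap α hα)
    obtain ⟨x, hx, hslope⟩ := exists_hasDerivAt_eq_slope (baseF r α 2 u) _ one_lt_two hcont
      (fun x hx => hasDerivAt_AN_v hM hM' hr hf 0 hu hx.1)
    have h1 := h u x hu hx.1
    have h2 := r_upper hM hM' hr hu hx.1.le
    have e : baseF r α 2 u 2 - baseF r α 2 u 1 = wt M r u x * AN M r (baseF r α 2) 1 u x := by
      rw [hslope]; norm_num
    rw [e, norm_div, Real.norm_eq_abs, norm_pow, Real.norm_of_nonneg (by linarith : 0 ≤ -u),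
      div_le_iff₀ (by nlinarith)]
    have e2 : 3 * c * (-u)⁻¹ * (-u) ^ 2 = c * (3 * (-u)) := by
      have : u ≠ 0 := by linarith
      field_simp
    rw [e2]
    refine h1.trans (mul_le_mul_of_nonneg_left ?_ hc)
    linarith [hx.2]
  have := herr.add hcone
  rw [zero_add] at this
  refine this.congr fun u => ?_
  rw [← add_div, sub_add_cancel]
  rfl

/-- The leading coefficients of `A^N` along outgoing-cone data `r² 𝒜`. -/
def aSeq (ℓ : ℕ) : ℕ → ℝ
  | 0 => 1
  | N + 1 => -cCoef ℓ N / (N + 3) * aSeq ℓ N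

lemma tendsto_AN_two (hM : 0 < M) (hM' : M ≤ 1 / 8) (hr : IsSchwR M r) {K : ℕ}
    (hα : ContDiffOn ℝ (⊤ : ℕ∞) (fun p : ℝ × ℝ => α p.1 p.2) D)
    (hT : TeukEq M r α 2 (K + 2)) (hdata : PlusData M r α (K + 2) A B C ε C₀ C₁) (N : ℕ)
    (hN : N ≤ K) :
    Tendsto (fun u => AN M r (baseF r α 2) N u 2 / (-u) ^ (N + 2)) atBot
      (𝓝 (aSeq (K + 2) N * A)) := by
  induction N with
  | zero => simpa [aSeq] using tendsto_AN_zero_two hM hM' hr hα hT hdata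
  | succ N ih =>
    have ih' := ih (by lia)
    have hv : (1 : ℝ) < 2 := one_lt_two
    have hrt := tendsto_r_atBot hM hr hv.le
    have hinv : Tendsto (fun u => (r u 2)⁻¹) atBot (𝓝 0) := hrt.inv_tendsto_atTop
    have hrat := tendsto_r_div_neg hM hM' hr hv.le
    have hC := hdata.hC₁
    have hwz : Tendsto (fun u => wt M r u 2 * (-u) ^ 2) atBot (𝓝 1) := by
      have h1 : Tendsto (fun u => (1 - 2 * M * (r u 2)⁻¹) * ((r u 2 / (-u)) ^ 2)⁻¹)
          atBot (𝓝 1) := by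
        simpa using ((hinv.const_mul (2 * M)).const_sub 1).mul ((hrat.pow 2).inv₀ (by norm_num))
      refine h1.congr' ?_
      filter_upwards [eventually_le_atBot (-1)] with u hu
      have := one_le_r hM hr hu hv.le
      have : u ≠ 0 := by linarith
      rw [wt, Om2]
      field_simp
    have hE : Tendsto (fun u => eCoef N * AN M r (baseF r α 2) (N - 1) u 2 / (-u) ^ (N + 2))
        atBot (𝓝 0) := by
      have hlim : Tendsto (fun u => eCoef N * (6 * C₁) * (r u 2 / (-u)) ^ (N + 2) * (r u 2)⁻¹)
          atBot (𝓝 0) := by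
        simpa using ((hrat.pow (N + 2)).const_mul (eCoef N * (6 * C₁))).mul hinv
      refine squeeze_zero_norm' ?_ hlim
      filter_upwards [eventually_le_atBot (-1)] with u hu
      have h1 := one_le_r hM hr hu hv.le
      have hz : 0 < -u := by linarith
      have := eCoef_mul_abs_AN_le hM hM' hr hdata (by lia : N ≤ K + 2 - 2) hu hv.le
      rw [norm_div, norm_mul, Real.norm_of_nonneg (eCoef_nonneg N), norm_pow,
        Real.norm_of_nonneg hz.le, Real.norm_eq_abs, div_le_iff₀ (by positivity)]
      refine this.trans (le_of_eq ?_)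
      rw [div_pow]
      field_simp
      ring
    have hRhs : Tendsto (fun u => commRhs M r (baseF r α 2) (K + 2) N u 2 / (-u) ^ (N + 2))
        atBot (𝓝 (-cCoef (K + 2) N * (aSeq (K + 2) N * A))) := by
      have h1 := ((((hinv.const_mul M).const_mul (dCoef N)).const_add (cCoef (K + 2) N)).neg.mul
        ih').add (hE.const_mul M)
      simp only [mul_zero, add_zero] at h1
      refine h1.congr fun u => ?_
      rw [commRhs]
      ring
    have hg : ∀ᶠ u : ℝ in atBot, HasDerivAt (fun u : ℝ => ((-u) ^ (N + 3))⁻¹)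
        ((N + 3) * ((-u) ^ (N + 4))⁻¹) u := by
      filter_upwards [eventually_le_atBot (-1)] with u hu
      have hz : -u ≠ 0 := by linarith
      refine (((hasDerivAt_neg u).fun_pow (N + 3)).fun_inv (pow_ne_zero _ hz)).congr_deriv ?_
      simp only [show N + 3 - 1 = N + 2 from rfl]
      push_cast
      field_simp
      ring
    have hg0 : Tendsto (fun u : ℝ => ((-u) ^ (N + 3))⁻¹) atBot (𝓝 0) :=
      ((tendsto_pow_atTop (by lia)).comp tendsto_neg_atBot_atTop).inv_tendsto_atTop
    have hlop := HasDerivAt.lhopital_zero_atBot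
      (f := fun u => wt M r u 2 ^ (N + 3) * AN M r (baseF r α 2) (N + 1) u 2)
      (f' := fun u => wt M r u 2 ^ (N + 3) * commRhs M r (baseF r α 2) (K + 2) N u 2)
      (l := 𝓝 (-cCoef (K + 2) N * (aSeq (K + 2) N * A) / (N + 3)))
      (by
        filter_upwards [eventually_lt_atBot (-1)] with u hu
        exact hasDerivAt_wt_pow_mul_AN hM hM' hr hα hT N hu hv)
      hg
      (by
        filter_upwards [eventually_le_atBot (-1)] with u hu
        have hz : 0 < -u := by linarith
        positivity)
      (tendsto_wt_pow_mul_AN hM hM' hr hα hdata N hv) hg0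
      (by
        have h1 := ((hwz.pow (N + 3)).mul hRhs).div_const ((N : ℝ) + 3)
        rw [one_pow, one_mul] at h1
        refine h1.congr' ?_
        filter_upwards [eventually_le_atBot (-1)] with u hu
        have hz : -u ≠ 0 := by linarith
        generalize -u = z at hz ⊢
        field_simp
        ring)
    have hfin := hlop.mul ((hwz.pow (N + 3)).inv₀ (by norm_num))
    rw [one_pow, inv_one, mul_one] at hfin
    have e : aSeq (K + 2) (N + 1) * A = -cCoef (K + 2) N * (aSeq (K + 2) N * A) / (N + 3) := by
      rw [aSeq]; ring
    rw [e]
    refine hfin.congr' ?_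
    filter_upwards [eventually_le_atBot (-1)] with u hu
    have hz : -u ≠ 0 := by linarith
    have := (wt_pos hM hM' hr hu hv.le).ne'
    generalize -u = z at hz ⊢
    field_simp
    ring

end InitialData

section SmallErrors

variable {M : ℝ} {r α X Y X' : ℝ → ℝ → ℝ} {A B C ε C₀ C₁ : ℝ} {k : ℕ}

/-- `X = o(r^{k+1})`, in the quantitative form uniform on `{u ≤ -1, v ≥ 2}`. -/
def SmallErr (r : ℝ → ℝ → ℝ) (k : ℕ) (X : ℝ → ℝ → ℝ) : Prop :=
  ∀ η : ℝ, 0 < η → ∃ C : ℝ, 0 ≤ C ∧ ∀ u v : ℝ, u ≤ -1 → 2 ≤ v →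
    |X u v| ≤ η * r u v ^ (k + 1) + C * r u v ^ k

lemma SmallErr.add (hX : SmallErr r k X) (hY : SmallErr r k Y) :
    SmallErr r k (fun u v => X u v + Y u v) := fun η hη => by
  obtain ⟨c, hc, h⟩ := hX (η / 2) (by positivity)
  obtain ⟨c', hc', h'⟩ := hY (η / 2) (by positivity)
  refine ⟨c + c', by positivity, fun u v hu hv => ?_⟩
  have := abs_add_le (X u v) (Y u v)
  have := h u v hu hv
  have := h' u v hu hv
  linarith

lemma SmallErr.const_mul (hX : SmallErr r k X) (a : ℝ) :
    SmallErr r k (fun u v => a * X u v) := fun η hη => by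
  obtain ⟨c, hc, h⟩ := hX (η / (|a| + 1)) (by positivity)
  refine ⟨(|a| + 1) * c, by positivity, fun u v hu hv => ?_⟩
  have h1 := h u v hu hv
  rw [abs_mul]
  calc |a| * |X u v| ≤ (|a| + 1) * |X u v| := by gcongr; linarith
    _ ≤ (|a| + 1) * (η / (|a| + 1) * r u v ^ (k + 1) + c * r u v ^ k) := by gcongr
    _ = _ := by field_simp

lemma SmallErr.div_r (hM : 0 < M) (hr : IsSchwR M r) (hX : SmallErr r (k + 1) X) :
    SmallErr r k (fun u v => X u v / r u v) := fun η hη => by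
  obtain ⟨c, hc, h⟩ := hX η hη
  refine ⟨c, hc, fun u v hu hv => ?_⟩
  have h1 := one_le_r hM hr hu (by linarith : (1 : ℝ) ≤ v)
  rw [abs_div, abs_of_pos (by linarith : 0 < r u v), div_le_iff₀ (by linarith)]
  refine (h u v hu hv).trans (le_of_eq ?_)
  ring

lemma SmallErr.wt_mul (hM : 0 < M) (hM' : M ≤ 1 / 8) (hr : IsSchwR M r)
    (hX : SmallErr r (k + 2) X) : SmallErr r k (fun u v => wt M r u v * X u v) := fun η hη => by
  obtain ⟨c, hc, h⟩ := hX η hη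
  refine ⟨c, hc, fun u v hu hv => ?_⟩
  have hv' : 1 ≤ v := by linarith
  have h1 := one_le_r hM hr hu hv'
  have hw := wt_pos hM hM' hr hu hv'
  rw [abs_mul, abs_of_pos hw]
  calc _ ≤ (r u v ^ 2)⁻¹ * (η * r u v ^ (k + 2 + 1) + c * r u v ^ (k + 2)) :=
        mul_le_mul (wt_le hM hr hu hv') (h u v hu hv) (abs_nonneg _) (by positivity)
    _ = _ := by field_simp; ring

lemma smallErr_of_abs_le {c : ℝ} (hc : 0 ≤ c) (hM : 0 < M) (hr : IsSchwR M r)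
    (h : ∀ u v : ℝ, u ≤ -1 → 1 < v → |X u v| ≤ c * r u v ^ k) : SmallErr r k X := fun η hη => by
  refine ⟨c, hc, fun u v hu hv => (h u v hu (by linarith)).trans ?_⟩
  have := one_le_r hM hr hu (by linarith : (1 : ℝ) ≤ v)
  have : 0 ≤ η * r u v ^ (k + 1) := by positivity
  linarith

lemma neg_le_two_mul_r (hM : 0 < M) (hr : IsSchwR M r) {u v : ℝ} (hu : u ≤ -1) (hv : 1 ≤ v) :
    -u ≤ 2 * r u v := by
  have := r_lower hM hr hu hv; linarith

lemma smallErr_of_tendsto (hM : 0 < M) (hr : IsSchwR M r) {g : ℝ → ℝ} {c : ℝ}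
    (hlim : Tendsto (fun u => g u / (-u) ^ (k + 1)) atBot (𝓝 0))
    (hg : ∀ u : ℝ, u ≤ -1 → |g u| ≤ c * (-u) ^ (k + 1)) : SmallErr r k (fun u _ => g u) := by
  intro η hη
  have hc : 0 ≤ c := by simpa using (abs_nonneg _).trans (hg (-1) le_rfl)
  have hev := (tendsto_order.1 hlim.abs).2 (η / 2 ^ (k + 1)) (by simp; positivity)
  obtain ⟨U, hU⟩ := eventually_atBot.1 hev
  refine ⟨c * |U| * 2 ^ k, by positivity, fun u v hu hv => ?_⟩
  have h1 := one_le_r hM hr hu (by linarith : (1 : ℝ) ≤ v)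
  have h2 := neg_le_two_mul_r hM hr hu (by linarith : (1 : ℝ) ≤ v)
  have hz : 0 < -u := by linarith
  rcases le_or_gt u U with h | h
  · have h3 := hU u h
    rw [abs_div, abs_of_pos (pow_pos hz _), div_lt_iff₀ (pow_pos hz _)] at h3
    calc |g u| ≤ η / 2 ^ (k + 1) * (-u) ^ (k + 1) := h3.le
      _ ≤ η / 2 ^ (k + 1) * (2 * r u v) ^ (k + 1) := by gcongr
      _ = η * r u v ^ (k + 1) := by rw [mul_pow]; field_simp
      _ ≤ _ := by
        have : 0 ≤ c * |U| * 2 ^ k * r u v ^ k := by positivity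
        linarith
  · have h3 : -u ≤ |U| := by linarith [neg_abs_le U]
    calc |g u| ≤ c * ((-u) * (-u) ^ k) := by rw [← pow_succ']; exact hg u hu
      _ ≤ c * (|U| * (2 * r u v) ^ k) := by gcongr
      _ = c * |U| * 2 ^ k * r u v ^ k := by rw [mul_pow]; ring
      _ ≤ _ := by
        have : 0 ≤ η * r u v ^ (k + 1) := by positivity
        linarith

lemma r_mono_v (hM : 0 < M) (hM' : M ≤ 1 / 8) (hr : IsSchwR M r) {u v w : ℝ} (hu : u ≤ -1)
    (hv : 1 < v) (hvw : v ≤ w) : r u v ≤ r u w := by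
  have hd : ∀ x, 1 < x → HasDerivAt (r u) (Om2 M r u x) x := fun x hx => hasDerivAt_r_v hr hu hx
  refine monotoneOn_of_deriv_nonneg (convex_Ioi (1 : ℝ))
    (fun x hx => (hd x hx).continuousAt.continuousWithinAt) ?_ ?_ hv (hv.trans_le hvw) hvw
  · rw [interior_Ioi]
    exact fun x hx => (hd x hx).differentiableAt.differentiableWithinAt
  · rw [interior_Ioi]
    intro x hx
    rw [(hd x hx).deriv]
    linarith [Om2_lower hM hM' hr hu (le_of_lt hx)]

lemma smallErr_of_hasDerivAt (hM : 0 < M) (hM' : M ≤ 1 / 8) (hr : IsSchwR M r)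
    (h2 : SmallErr r (k + 1) (fun u _ => X u 2))
    (hd : ∀ u v : ℝ, u ≤ -1 → 1 < v → HasDerivAt (X u) (X' u v) v) (hX' : SmallErr r k X') :
    SmallErr r (k + 1) X := by
  intro η hη
  obtain ⟨c, hc, h⟩ := h2 (η / 3) (by positivity)
  obtain ⟨c', hc', h'⟩ := hX' (η / 3) (by positivity)
  refine ⟨c + 2 * c', by positivity, fun u v hu hv => ?_⟩
  have hv' : 1 ≤ v := by linarith
  have h1 := one_le_r hM hr hu hv'
  set S : ℝ := η / 3 * r u v ^ (k + 1) + c' * r u v ^ k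
  have hS : 0 ≤ S := by positivity
  have hmv := (convex_Icc 2 v).norm_image_sub_le_of_norm_hasDerivWithin_le (f := X u)
    (f' := X' u) (C := S) (fun x hx => (hd u x hu (by linarith [hx.1])).hasDerivWithinAt)
    (fun x hx => ?_) (left_mem_Icc.2 hv) (right_mem_Icc.2 hv)
  · rw [Real.norm_eq_abs, Real.norm_eq_abs, abs_of_nonneg (by linarith : 0 ≤ v - 2)] at hmv
    have hvr : v - 2 ≤ 2 * r u v := by
      have := r_lower hM hr hu hv'; linarith
    have h3 := mul_le_mul_of_nonneg_left hvr hS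
    have h4 := h u v hu hv
    have h5 := abs_add_le (X u v - X u 2) (X u 2)
    rw [sub_add_cancel] at h5
    have e : S * (2 * r u v) = 2 * (η / 3) * r u v ^ (k + 1 + 1) + 2 * c' * r u v ^ (k + 1) := by
      simp only [S]; ring
    linarith
  · rw [Real.norm_eq_abs]
    refine (h' u x hu hx.1).trans ?_
    have h3 := one_le_r hM hr hu (by linarith [hx.1] : 1 ≤ x)
    have h4 := r_mono_v hM hM' hr hu (by linarith [hx.1] : 1 < x) hx.2
    simp only [S]
    gcongr

lemma smallErr_AN_top (hM : 0 < M) (hM' : M ≤ 1 / 8) (hr : IsSchwR M r) {K : ℕ}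
    (hα : ContDiffOn ℝ (⊤ : ℕ∞) (fun p : ℝ × ℝ => α p.1 p.2) D)
    (hT : TeukEq M r α 2 (K + 2)) (hdata : PlusData M r α (K + 2) A B C ε C₀ C₁) :
    SmallErr r (K + 1)
      (fun u v => AN M r (baseF r α 2) K u v - aSeq (K + 2) K * A * (-u) ^ (K + 2)) := by
  have hf := smoothPos_baseF hr hα
  obtain ⟨c, hc, h⟩ := exists_abs_wt_mul_AN_top_le hM hM' hr hα hT hdata
  refine smallErr_of_hasDerivAt hM hM' hr
    (smallErr_of_tendsto (c := 6 * C₁ * 3 ^ (K + 2) + |aSeq (K + 2) K * A|) hM hr ?_ ?_)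
    (fun u v hu hv => (hasDerivAt_AN_v hM hM' hr hf K hu hv).sub_const _)
    (smallErr_of_abs_le hc hM hr h)
  · have h1 := (tendsto_AN_two hM hM' hr hα hT hdata K le_rfl).sub_const (aSeq (K + 2) K * A)
    rw [sub_self] at h1
    refine h1.congr' ?_
    filter_upwards [eventually_le_atBot (-1)] with u hu
    have hz : -u ≠ 0 := by linarith
    rw [sub_div, mul_div_cancel_right₀ _ (pow_ne_zero _ hz)]
  · intro u hu
    have hz : 0 < -u := by linarith
    have h1 := abs_AN_le hM hM' hr hdata (by lia : K ≤ K + 2 - 2) hu one_le_two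
    have h2 : r u 2 ≤ 3 * -u := by linarith [r_upper hM hM' hr hu one_le_two]
    have h3 := one_le_r hM hr hu one_le_two
    have hC := hdata.hC₁
    have h4 : r u 2 ^ (K + 2) ≤ 3 ^ (K + 2) * (-u) ^ (K + 2) := by rw [← mul_pow]; gcongr
    have h5 := mul_le_mul_of_nonneg_left h4 (by positivity : 0 ≤ 6 * C₁)
    refine (abs_sub _ _).trans ?_
    rw [abs_mul _ ((-u) ^ (K + 2)), abs_of_pos (pow_pos hz _)]
    simp only [show K + 1 + 1 = K + 2 from rfl]
    linarith

lemma aSeq_succ_self (K : ℕ) : aSeq (K + 3) (K + 1) = -2 * aSeq (K + 3) K := by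
  rw [aSeq, cCoef]
  push_cast
  field_simp
  ring

lemma smallErr_AN_pred (hM : 0 < M) (hM' : M ≤ 1 / 8) (hr : IsSchwR M r) {K : ℕ}
    (hα : ContDiffOn ℝ (⊤ : ℕ∞) (fun p : ℝ × ℝ => α p.1 p.2) D)
    (hT : TeukEq M r α 2 (K + 3)) (hdata : PlusData M r α (K + 3) A B C ε C₀ C₁) :
    SmallErr r (K + 1) (fun u v => AN M r (baseF r α 2) K u v
      - aSeq (K + 3) (K + 1) * A / 2 * (-u) ^ (K + 2)
      + aSeq (K + 3) (K + 1) * A * (-u) ^ (K + 3) / r u v) := by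
  have hf := smoothPos_baseF hr hα
  set a := aSeq (K + 3) (K + 1) * A with ha
  have hrat := tendsto_r_div_neg hM hM' hr one_le_two
  refine smallErr_of_hasDerivAt hM hM' hr
    (smallErr_of_tendsto (c := 6 * C₁ * 3 ^ (K + 2) + |a| + 2 * |a|) hM hr ?_ ?_)
    (X' := fun u v => wt M r u v * (AN M r (baseF r α 2) (K + 1) u v - a * (-u) ^ (K + 3)))
    (fun u v hu hv => ?_)
    (SmallErr.wt_mul hM hM' hr (smallErr_AN_top (K := K + 1) hM hM' hr hα hT hdata))
  · have h1 := ((tendsto_AN_two (K := K + 1) hM hM' hr hα hT hdata K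
      (by lia : K ≤ K + 1)).sub_const (a / 2)).add ((hrat.inv₀ one_ne_zero).const_mul a)
    have e : aSeq (K + 1 + 2) K * A - a / 2 + a * 1⁻¹ = 0 := by
      rw [ha, aSeq_succ_self]; ring
    rw [e] at h1
    refine h1.congr' ?_
    filter_upwards [eventually_le_atBot (-1)] with u hu
    have hz : -u ≠ 0 := by linarith
    have h3 := one_le_r hM hr hu one_le_two
    generalize -u = z at hz ⊢
    field_simp
    ring
  · intro u hu
    have hz : 0 < -u := by linarith
    have h1 := abs_AN_le hM hM' hr hdata (by lia : K ≤ K + 3 - 2) hu one_le_two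
    have h2 : r u 2 ≤ 3 * -u := by linarith [r_upper hM hM' hr hu one_le_two]
    have h3 := one_le_r hM hr hu one_le_two
    have hC := hdata.hC₁
    have h4 : r u 2 ^ (K + 2) ≤ 3 ^ (K + 2) * (-u) ^ (K + 2) := by rw [← mul_pow]; gcongr
    have h5 := mul_le_mul_of_nonneg_left h4 (by positivity : 0 ≤ 6 * C₁)
    have h6 := neg_le_two_mul_r hM hr hu one_le_two
    have e1 : |a / 2 * (-u) ^ (K + 2)| ≤ |a| * (-u) ^ (K + 2) := by
      rw [abs_mul, abs_of_pos (pow_pos hz _), abs_div, abs_two]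
      gcongr
      linarith [abs_nonneg a]
    have e2 : |a * (-u) ^ (K + 3) / r u 2| ≤ 2 * |a| * (-u) ^ (K + 2) := by
      rw [abs_div, abs_mul, abs_of_pos (pow_pos hz _), abs_of_pos (by linarith : 0 < r u 2),
        div_le_iff₀ (by linarith)]
      calc |a| * (-u) ^ (K + 3) = |a| * (-u) ^ (K + 2) * -u := by ring
        _ ≤ |a| * (-u) ^ (K + 2) * (2 * r u 2) := by gcongr
        _ = _ := by ring
    refine (abs_add_le _ _).trans ?_
    have := abs_sub (AN M r (baseF r α 2) K u 2) (a / 2 * (-u) ^ (K + 2))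
    simp only [show K + 1 + 1 = K + 2 from rfl]
    linarith
  · have h3 := one_le_r hM hr hu hv.le
    have h1 := ((hasDerivAt_AN_v hM hM' hr hf K hu hv).sub_const (a / 2 * (-u) ^ (K + 2))).add
      ((hasDerivAt_const v (a * (-u) ^ (K + 3))).fun_div (hasDerivAt_r_v hr hu hv) (by linarith))
    refine h1.congr_deriv ?_
    rw [wt]
    field_simp
    ring

/-- The leading part of the commuted right-hand side at the top order. -/
def mainRhs (M a : ℝ) (r : ℝ → ℝ → ℝ) (K : ℕ) (u v : ℝ) : ℝ :=
  M * a * (-(dCoef K + eCoef K) * ((-u) ^ (K + 2) / r u v) + eCoef K / 2 * (-u) ^ (K + 1))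

lemma smallErr_commRhs_sub (hM : 0 < M) (hM' : M ≤ 1 / 8) (hr : IsSchwR M r) {K : ℕ}
    (hα : ContDiffOn ℝ (⊤ : ℕ∞) (fun p : ℝ × ℝ => α p.1 p.2) D)
    (hT : TeukEq M r α 2 (K + 2)) (hdata : PlusData M r α (K + 2) A B C ε C₀ C₁) :
    SmallErr r K (fun u v => commRhs M r (baseF r α 2) (K + 2) K u v
      - mainRhs M (aSeq (K + 2) K * A) r K u v) := by
  have h1 := ((smallErr_AN_top hM hM' hr hα hT hdata).div_r hM hr).const_mul (-(dCoef K * M))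
  have h2 : SmallErr r K (fun u v => eCoef K * M * (AN M r (baseF r α 2) (K - 1) u v
      - aSeq (K + 2) K * A / 2 * (-u) ^ (K + 1)
      + aSeq (K + 2) K * A * (-u) ^ (K + 2) / r u v)) := by
    rcases K with _ | K
    · refine smallErr_of_abs_le le_rfl hM hr fun u v _ _ => ?_
      simp [eCoef]
    · exact (smallErr_AN_pred hM hM' hr hα hT hdata).const_mul (eCoef (K + 1) * M)
  refine cast (congrArg (SmallErr r K) ?_) (h1.add h2)
  funext u v
  rw [commRhs, mainRhs, cCoef_top]
  ring

end SmallErrors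

section ModelIntegrals

variable {M : ℝ} {r α : ℝ → ℝ → ℝ} {A B C ε C₀ C₁ : ℝ}

/-- Approximate primitives in `u`, vanishing at past null infinity, of
`(-u)^a r^{-(a+m+1)}`. -/
def primJ (r : ℝ → ℝ → ℝ) (m : ℕ) : ℕ → ℝ → ℝ → ℝ
  | 0 => fun u v => (r u v ^ m)⁻¹ / m
  | a + 1 => fun u v =>
      ((-u) ^ (a + 1) * (r u v ^ (a + 1 + m))⁻¹ + (a + 1) * primJ r m a u v) / (a + 1 + m : ℕ)

/-- The limits of `r^m` times the approximate primitives. -/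
def betaSeq (m : ℕ) : ℕ → ℝ
  | 0 => 1 / m
  | a + 1 => (a + 1) * betaSeq m a / (a + 1 + m : ℕ)

lemma exists_hasDerivAt_primJ (hM : 0 < M) (hr : IsSchwR M r) {m : ℕ} (hm : m ≠ 0) (a : ℕ) :
    ∃ c : ℝ, 0 ≤ c ∧ ∀ u v : ℝ, u < -1 → 1 < v → ∃ d : ℝ,
      HasDerivAt (fun u' => primJ r m a u' v) d u ∧
      |d - (-u) ^ a * (r u v ^ (a + m + 1))⁻¹| ≤ c * (r u v ^ (m + 2))⁻¹ := by
  have hm' : (m : ℝ) ≠ 0 := by exact_mod_cast hm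
  induction a with
  | zero =>
    refine ⟨2 * M, by positivity, fun u v hu hv => ⟨_,
      (hasDerivAt_inv_r_pow_u hM hr m hu hv).div_const (m : ℝ), le_of_eq ?_⟩⟩
    have h1 := one_le_r hM hr hu.le hv.le
    have e : (m : ℝ) * Om2 M r u v * (r u v ^ (m + 1))⁻¹ / m
        - (-u) ^ 0 * (r u v ^ (0 + m + 1))⁻¹ = -(2 * M * (r u v ^ (m + 2))⁻¹) := by
      rw [Om2, zero_add]
      field_simp
      ring
    rw [e, abs_neg, abs_of_nonneg (by positivity)]
  | succ a ih =>
    obtain ⟨c, hc, h⟩ := ih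
    refine ⟨2 * M * 2 ^ (a + 1) + (a + 1) * c, by positivity, fun u v hu hv => ?_⟩
    obtain ⟨d, hd, hle⟩ := h u v hu hv
    have h1 := one_le_r hM hr hu.le hv.le
    have hz : 0 < -u := by linarith
    have hpow : HasDerivAt (fun u' : ℝ => (-u') ^ (a + 1)) (-((a + 1) * (-u) ^ a)) u := by
      refine ((hasDerivAt_neg u).fun_pow (a + 1)).congr_deriv ?_
      simp
    refine ⟨_, ((hpow.fun_mul (hasDerivAt_inv_r_pow_u hM hr (a + 1 + m) hu hv)).fun_add
      (hd.const_mul ((a : ℝ) + 1))).div_const _, ?_⟩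
    set n : ℝ := ((a + 1 + m : ℕ) : ℝ) with hn
    have hn1 : 1 ≤ n := by rw [hn]; exact_mod_cast (by lia : 1 ≤ a + 1 + m)
    have e : (-((a + 1) * (-u) ^ a) * (r u v ^ (a + 1 + m))⁻¹
        + (-u) ^ (a + 1) * (n * Om2 M r u v * (r u v ^ (a + 1 + m + 1))⁻¹) + (a + 1) * d) / n
        - (-u) ^ (a + 1) * (r u v ^ (a + 1 + m + 1))⁻¹
        = -(2 * M * (-u) ^ (a + 1) * (r u v ^ (a + m + 3))⁻¹)
          + (a + 1) / n * (d - (-u) ^ a * (r u v ^ (a + m + 1))⁻¹) := by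
      rw [Om2, show a + 1 + m + 1 = a + m + 2 by ring, show a + 1 + m = a + m + 1 by ring]
      field_simp
      ring
    rw [e]
    refine (abs_add_le _ _).trans ?_
    rw [abs_neg, abs_of_pos (by positivity), abs_mul, abs_of_pos (by positivity)]
    have e1 : 2 * M * (-u) ^ (a + 1) * (r u v ^ (a + m + 3))⁻¹ ≤
        2 * M * 2 ^ (a + 1) * (r u v ^ (m + 2))⁻¹ := by
      have h2 := neg_le_two_mul_r hM hr hu.le hv.le
      calc _ ≤ 2 * M * (2 * r u v) ^ (a + 1) * (r u v ^ (a + m + 3))⁻¹ := by gcongr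
        _ = _ := by
          rw [mul_pow]
          field_simp
          ring
    have e2 : (a + 1) / n * |d - (-u) ^ a * (r u v ^ (a + m + 1))⁻¹| ≤
        (a + 1) * (c * (r u v ^ (m + 2))⁻¹) := by
      gcongr
      exact div_le_self (by positivity) hn1
    linarith

lemma continuousOn_primJ (hM : 0 < M) (hr : IsSchwR M r) {v : ℝ} (hv : 1 < v) (m a : ℕ) :
    ContinuousOn (fun u => primJ r m a u v) (Iic (-1)) := by
  have hcont : ∀ j : ℕ, ContinuousOn (fun u => (r u v ^ j)⁻¹) (Iic (-1)) := fun j =>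
    (((smoothPos_r hr).continuousOn_u hv).pow j).inv₀ fun x hx => by
      have := one_le_r hM hr hx hv.le
      exact pow_ne_zero _ (by linarith)
  induction a with
  | zero => exact (hcont m).div_const _
  | succ a ih =>
    exact (((by fun_prop : ContinuousOn (fun u : ℝ => (-u) ^ (a + 1)) (Iic (-1))).mul
      (hcont _)).add (continuousOn_const.mul ih)).div_const _

lemma tendsto_primJ_atBot (hM : 0 < M) (hr : IsSchwR M r) {v : ℝ} (hv : 1 < v) {m : ℕ}
    (hm : m ≠ 0) (a : ℕ) : Tendsto (fun u => primJ r m a u v) atBot (𝓝 0) := by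
  have h0 := tendsto_inv_r_pow_atBot hM hr hm hv.le
  induction a with
  | zero => simpa [primJ] using h0.div_const (m : ℝ)
  | succ a ih =>
    have h1 : Tendsto (fun u => (-u) ^ (a + 1) * (r u v ^ (a + 1 + m))⁻¹) atBot (𝓝 0) := by
      refine squeeze_zero_norm' (a := fun u => 2 ^ (a + 1) * (r u v ^ m)⁻¹) ?_
        (by simpa using h0.const_mul (2 ^ (a + 1)))
      filter_upwards [eventually_le_atBot (-1)] with u hu
      have h1 := one_le_r hM hr hu hv.le
      have h2 := neg_le_two_mul_r hM hr hu hv.le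
      have hz : 0 < -u := by linarith
      rw [Real.norm_of_nonneg (by positivity)]
      calc _ ≤ (2 * r u v) ^ (a + 1) * (r u v ^ (a + 1 + m))⁻¹ := by gcongr
        _ = _ := by
          rw [mul_pow]
          field_simp
          ring
    simpa [primJ] using (h1.add (ih.const_mul ((a : ℝ) + 1))).div_const ((a + 1 + m : ℕ) : ℝ)

lemma tendsto_r_atTop (hM : 0 < M) (hr : IsSchwR M r) {u : ℝ} (hu : u ≤ -1) :
    Tendsto (fun v => r u v) atTop atTop := by
  refine tendsto_atTop_mono' atTop (f₁ := fun v => v / 2) ?_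
    (tendsto_id.atTop_div_const two_pos)
  filter_upwards [eventually_ge_atTop 1] with v hv
  linarith [r_lower hM hr hu hv]

lemma tendsto_r_pow_mul_primJ (hM : 0 < M) (hr : IsSchwR M r) {u : ℝ} (hu : u ≤ -1) (m a : ℕ) :
    Tendsto (fun v => r u v ^ m * primJ r m a u v) atTop (𝓝 (betaSeq m a)) := by
  induction a with
  | zero =>
    refine tendsto_const_nhds.congr' ?_
    filter_upwards [eventually_ge_atTop 1] with v hv
    have h1 := one_le_r hM hr hu hv
    simp only [primJ, betaSeq]
    field_simp
  | succ a ih =>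
    have h0 : Tendsto (fun v => (r u v ^ (a + 1))⁻¹) atTop (𝓝 0) :=
      ((tendsto_pow_atTop (by lia)).comp (tendsto_r_atTop hM hr hu)).inv_tendsto_atTop
    have h1 := ((h0.const_mul ((-u) ^ (a + 1))).add (ih.const_mul ((a : ℝ) + 1))).div_const
      ((a + 1 + m : ℕ) : ℝ)
    rw [mul_zero, zero_add] at h1
    refine h1.congr' ?_
    filter_upwards [eventually_ge_atTop 1] with v hv
    have h1 := one_le_r hM hr hu hv
    simp only [primJ]
    generalize -u = z
    rw [pow_add _ (a + 1) m]
    field_simp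

lemma betaSeq_eq (n a : ℕ) :
    betaSeq (n + 1) a = (a.factorial : ℝ) * n.factorial / (a + n + 1).factorial := by
  induction a with
  | zero =>
    rw [betaSeq, zero_add, Nat.factorial_succ]
    push_cast
    field_simp
    simp
  | succ a ih =>
    rw [betaSeq, ih, show a + 1 + n + 1 = (a + n + 1) + 1 by ring, Nat.factorial_succ (a + n + 1),
      Nat.factorial_succ a]
    push_cast
    field_simp
    ring

lemma aSeq_eq (j N : ℕ) : aSeq (N + j + 2) N = (-1) ^ N * 2 * ((N + j).factorial : ℝ) *
    (2 * N + j + 4).factorial / (j.factorial * (N + j + 4).factorial * (N + 2).factorial) := by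
  induction N generalizing j with
  | zero =>
    simp only [aSeq, zero_add, Nat.mul_zero]
    field_simp
    simp [Nat.factorial]
  | succ N ih =>
    have h := ih (j + 1)
    rw [show N + 1 + j + 2 = N + (j + 1) + 2 by ring, aSeq, h, cCoef,
      show 2 * (N + 1) + j + 4 = (2 * N + (j + 1) + 4) + 1 by ring,
      Nat.factorial_succ (2 * N + (j + 1) + 4), Nat.factorial_succ j,
      show N + 1 + 2 = (N + 2) + 1 by ring, Nat.factorial_succ (N + 2),
      show N + 1 + j = N + (j + 1) by ring]
    push_cast
    field_simp
    ring

end ModelIntegrals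

section Limit

variable {M : ℝ} {r α : ℝ → ℝ → ℝ} {A B C ε C₀ C₁ : ℝ}

lemma exists_abs_mainRhs_le (hM : 0 < M) (hr : IsSchwR M r) (a : ℝ) (K : ℕ) :
    ∃ c : ℝ, 0 ≤ c ∧ ∀ u v : ℝ, u ≤ -1 → 1 < v → |mainRhs M a r K u v| ≤ c * r u v ^ (K + 1) := by
  have hd := dCoef_nonneg K
  have he := eCoef_nonneg K
  refine ⟨M * |a| * ((dCoef K + eCoef K) * 2 ^ (K + 2) + eCoef K / 2 * 2 ^ (K + 1)), by positivity,
    fun u v hu hv => ?_⟩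
  have h1 := one_le_r hM hr hu hv.le
  have h2 := neg_le_two_mul_r hM hr hu hv.le
  have hz : 0 < -u := by linarith
  rw [mainRhs, abs_mul, abs_mul, abs_of_pos hM, mul_assoc (M * |a|)]
  refine mul_le_mul_of_nonneg_left ?_ (by positivity)
  refine (abs_add_le _ _).trans ?_
  rw [neg_mul, abs_neg, abs_of_nonneg (by positivity), abs_of_nonneg (by positivity)]
  have e1 : (-u) ^ (K + 2) / r u v ≤ 2 ^ (K + 2) * r u v ^ (K + 1) := by
    rw [div_le_iff₀ (by linarith)]
    calc (-u) ^ (K + 2) ≤ (2 * r u v) ^ (K + 2) := by gcongr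
      _ = _ := by ring
  have e2 : (-u) ^ (K + 1) ≤ 2 ^ (K + 1) * r u v ^ (K + 1) := by
    rw [← mul_pow]
    gcongr
  have e3 := mul_le_mul_of_nonneg_left e1 (by positivity : 0 ≤ dCoef K + eCoef K)
  have e4 := mul_le_mul_of_nonneg_left e2 (by positivity : 0 ≤ eCoef K / 2)
  linarith

lemma abs_wt_pow_sub_le (hM : 0 < M) (hM' : M ≤ 1 / 8) (hr : IsSchwR M r) (n : ℕ) {u v : ℝ}
    (hu : u ≤ -1) (hv : 1 ≤ v) :
    |wt M r u v ^ n - (r u v ^ (2 * n))⁻¹| ≤ n * (2 * M) * (r u v ^ (2 * n + 1))⁻¹ := by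
  have h1 := one_le_r hM hr hu hv
  have h2 := Om2_lower hM hM' hr hu hv
  have h3 := wt_pow_le hM hM' hr hu hv n
  have h4 : 1 + n * (Om2 M r u v - 1) ≤ Om2 M r u v ^ n :=
    one_add_mul_sub_le_pow (by linarith) n
  rw [abs_sub_comm, abs_of_nonneg (by linarith), wt, div_pow, ← pow_mul]
  have e : (r u v ^ (2 * n))⁻¹ - Om2 M r u v ^ n / r u v ^ (2 * n) =
      (1 - Om2 M r u v ^ n) * (r u v ^ (2 * n))⁻¹ := by ring
  rw [e]
  calc _ ≤ n * (1 - Om2 M r u v) * (r u v ^ (2 * n))⁻¹ := by gcongr; linarith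
    _ = _ := by rw [Om2]; field_simp; ring

lemma exists_abs_primitive_sub_le (hM : 0 < M) (hM' : M ≤ 1 / 8) (hr : IsSchwR M r) {K : ℕ}
    (hα : ContDiffOn ℝ (⊤ : ℕ∞) (fun p : ℝ × ℝ => α p.1 p.2) D)
    (hT : TeukEq M r α 2 (K + 2)) (hdata : PlusData M r α (K + 2) A B C ε C₀ C₁) {η : ℝ}
    (hη : 0 < η) :
    ∃ c : ℝ, 0 ≤ c ∧ ∀ u v : ℝ, u ≤ -1 → 2 ≤ v →
      |wt M r u v ^ (K + 3) * AN M r (baseF r α 2) (K + 1) u v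
        - M * (aSeq (K + 2) K * A) * (-(dCoef K + eCoef K) * primJ r (K + 4) (K + 2) u v
          + eCoef K / 2 * primJ r (K + 4) (K + 1) u v)|
        ≤ η * (r u v ^ (K + 4))⁻¹ + c * (r u v ^ (K + 5))⁻¹ := by
  set a := aSeq (K + 2) K * A
  have hd := dCoef_nonneg K
  have he := eCoef_nonneg K
  obtain ⟨c₁, hc₁, h₁⟩ := smallErr_commRhs_sub hM hM' hr hα hT hdata (η / 2) (by positivity)
  obtain ⟨c₂, hc₂, h₂⟩ := exists_abs_mainRhs_le hM hr a K
  obtain ⟨c₃, hc₃, h₃⟩ := exists_hasDerivAt_primJ hM hr (by lia : K + 4 ≠ 0) (K + 2)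
  obtain ⟨c₄, hc₄, h₄⟩ := exists_hasDerivAt_primJ hM hr (by lia : K + 4 ≠ 0) (K + 1)
  set c : ℝ := c₁ + (K + 3 : ℕ) * (2 * M) * c₂
    + M * |a| * ((dCoef K + eCoef K) * c₃ + eCoef K / 2 * c₄) with hc
  refine ⟨2 * c, by positivity, fun u v hu hv => ?_⟩
  have hv' : 1 < v := by linarith
  have hJ : ∀ j, ContinuousOn (fun u => primJ r (K + 4) j u v) (Iic (-1)) :=
    continuousOn_primJ hM hr hv' (K + 4)
  have hJ0 : ∀ j, Tendsto (fun u => primJ r (K + 4) j u v) atBot (𝓝 0) :=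
    tendsto_primJ_atBot hM hr hv' (by lia)
  have hwc : ContinuousOn (fun u => wt M r u v) (Iic (-1)) := by
    have h1 := (smoothPos_Om2 hM hr).continuousOn_u hv'
    have h2 := (smoothPos_r hr).continuousOn_u hv'
    exact h1.div (h2.pow 2) fun x hx => by have := one_le_r hM hr hx hv'.le; positivity
  have hAc := (smoothPos_AN hM hM' hr (smoothPos_baseF hr hα) (K + 1)).continuousOn_u hv'
  choose! d₃ hd₃ hle₃ using fun x hx => h₃ x v hx hv'
  choose! d₄ hd₄ hle₄ using fun x hx => h₄ x v hx hv'
  have hmain := abs_le_inv_r_pow hM hM' hr (k := K + 4) hv' (by lia)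
    (F := fun u => wt M r u v ^ (K + 3) * AN M r (baseF r α 2) (K + 1) u v
        - M * a * (-(dCoef K + eCoef K) * primJ r (K + 4) (K + 2) u v
          + eCoef K / 2 * primJ r (K + 4) (K + 1) u v))
    (by positivity : 0 ≤ η / 2) (by positivity : 0 ≤ c)
    (((hwc.pow (K + 3)).mul hAc).sub (continuousOn_const.mul
      ((continuousOn_const.mul (hJ (K + 2))).add (continuousOn_const.mul (hJ (K + 1))))))
    (fun x hx => (hasDerivAt_wt_pow_mul_AN hM hM' hr hα hT K hx hv').sub
      ((((hd₃ x hx).const_mul _).add ((hd₄ x hx).const_mul _)).const_mul _))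
    (fun x hx => ?_) ?_ hu
  · refine hmain.trans (le_of_eq ?_)
    ring
  · have h1 := one_le_r hM hr hx.le hv'.le
    have hz : 0 < -x := by linarith
    have hw := wt_pow_le hM hM' hr hx.le hv'.le (K + 3)
    have hwp := pow_pos (wt_pos hM hM' hr hx.le hv'.le) (K + 3)
    have b₁ := h₁ x v hx.le hv
    have b₂ := h₂ x v hx.le hv'
    have b₃ := hle₃ x hx
    have b₄ := hle₄ x hx
    have bw := abs_wt_pow_sub_le hM hM' hr (K + 3) hx.le hv'.le
    set X := commRhs M r (baseF r α 2) (K + 2) K x v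
    set Y := mainRhs M a r K x v with hY
    have e : wt M r x v ^ (K + 3) * X
        - M * a * (-(dCoef K + eCoef K) * d₃ x + eCoef K / 2 * d₄ x)
        = wt M r x v ^ (K + 3) * (X - Y)
          + (wt M r x v ^ (K + 3) - (r x v ^ (2 * (K + 3)))⁻¹) * Y
          + M * a * ((dCoef K + eCoef K) *
              (d₃ x - (-x) ^ (K + 2) * (r x v ^ (K + 2 + (K + 4) + 1))⁻¹)
            + -(eCoef K / 2) *
              (d₄ x - (-x) ^ (K + 1) * (r x v ^ (K + 1 + (K + 4) + 1))⁻¹)) := by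
      have : (r x v ^ (2 * (K + 3)))⁻¹ * Y = M * a * (-(dCoef K + eCoef K) *
          ((-x) ^ (K + 2) * (r x v ^ (K + 2 + (K + 4) + 1))⁻¹)
          + eCoef K / 2 * ((-x) ^ (K + 1) * (r x v ^ (K + 1 + (K + 4) + 1))⁻¹)) := by
        rw [hY, mainRhs, show K + 2 + (K + 4) + 1 = 2 * (K + 3) + 1 by ring,
          show K + 1 + (K + 4) + 1 = 2 * (K + 3) by ring]
        generalize -x = z
        field_simp
        ring
      linear_combination this
    have t₁ : |wt M r x v ^ (K + 3) * (X - Y)| ≤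
        η / 2 * (r x v ^ (K + 5))⁻¹ + c₁ * (r x v ^ (K + 6))⁻¹ := by
      rw [abs_mul, abs_of_pos hwp]
      calc _ ≤ (r x v ^ (2 * (K + 3)))⁻¹ * (η / 2 * r x v ^ (K + 1) + c₁ * r x v ^ K) := by
            gcongr
        _ = _ := by
          rw [show 2 * (K + 3) = K + (K + 6) by ring]
          field_simp
          ring
    have t₂ : |(wt M r x v ^ (K + 3) - (r x v ^ (2 * (K + 3)))⁻¹) * Y| ≤
        (K + 3 : ℕ) * (2 * M) * c₂ * (r x v ^ (K + 6))⁻¹ := by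
      rw [abs_mul]
      calc _ ≤ (K + 3 : ℕ) * (2 * M) * (r x v ^ (2 * (K + 3) + 1))⁻¹ *
            (c₂ * r x v ^ (K + 1)) := by gcongr
        _ = _ := by
          rw [show 2 * (K + 3) + 1 = K + 1 + (K + 6) by ring, pow_add _ (K + 1)]
          field_simp
    have t₃ : |M * a * ((dCoef K + eCoef K) *
              (d₃ x - (-x) ^ (K + 2) * (r x v ^ (K + 2 + (K + 4) + 1))⁻¹)
            + -(eCoef K / 2) *
              (d₄ x - (-x) ^ (K + 1) * (r x v ^ (K + 1 + (K + 4) + 1))⁻¹))| ≤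
        M * |a| * ((dCoef K + eCoef K) * c₃ + eCoef K / 2 * c₄) * (r x v ^ (K + 6))⁻¹ := by
      rw [abs_mul, abs_mul, abs_of_pos hM, mul_assoc (M * |a|)]
      refine mul_le_mul_of_nonneg_left ?_ (by positivity)
      refine (abs_add_le _ _).trans ?_
      rw [neg_mul, abs_neg, abs_mul, abs_mul, abs_of_nonneg (by positivity : 0 ≤ dCoef K + eCoef K),
        abs_of_nonneg (by positivity : 0 ≤ eCoef K / 2)]
      have e₃ := mul_le_mul_of_nonneg_left b₃ (by positivity : 0 ≤ dCoef K + eCoef K)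
      have e₄ := mul_le_mul_of_nonneg_left b₄ (by positivity : 0 ≤ eCoef K / 2)
      simp only [show K + 4 + 2 = K + 6 from rfl] at e₃ e₄
      linarith
    rw [e]
    refine (abs_add_le _ _).trans ?_
    have t₁₂ := abs_add_le (wt M r x v ^ (K + 3) * (X - Y))
      ((wt M r x v ^ (K + 3) - (r x v ^ (2 * (K + 3)))⁻¹) * Y)
    have e' : c * (r x v ^ (K + 6))⁻¹ = c₁ * (r x v ^ (K + 6))⁻¹
        + (K + 3 : ℕ) * (2 * M) * c₂ * (r x v ^ (K + 6))⁻¹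
        + M * |a| * ((dCoef K + eCoef K) * c₃ + eCoef K / 2 * c₄) * (r x v ^ (K + 6))⁻¹ := by
      rw [hc]; ring
    simp only [show K + 4 + 1 = K + 5 from rfl, show K + 4 + 2 = K + 6 from rfl]
    linarith
  · have h1 := tendsto_wt_pow_mul_AN hM hM' hr hα hdata K hv'
    have h2 := (((hJ0 (K + 2)).const_mul (-(dCoef K + eCoef K))).add
      ((hJ0 (K + 1)).const_mul (eCoef K / 2))).const_mul (M * a)
    simpa using h1.sub h2

lemma limit_const_eq (K : ℕ) :
    M * (aSeq (K + 2) K * A) * (-(dCoef K + eCoef K) * betaSeq (K + 4) (K + 2)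
      + eCoef K / 2 * betaSeq (K + 4) (K + 1)) =
    (-1 : ℝ) ^ (K + 2 + 1) * (2 * (K.factorial : ℝ) * ((K + 2 + 1).factorial : ℝ) /
      ((K + 2 + 2).factorial : ℝ)) * M * A := by
  have h := aSeq_eq 0 K
  simp only [add_zero, Nat.factorial_zero, Nat.cast_one, one_mul] at h
  rw [h, betaSeq_eq (K + 3), betaSeq_eq (K + 3), dCoef, eCoef,
    show K + 2 + (K + 3) + 1 = (2 * K + 4) + 1 + 1 by ring,
    show K + 1 + (K + 3) + 1 = (2 * K + 4) + 1 by ring,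
    Nat.factorial_succ (2 * K + 4 + 1), Nat.factorial_succ (2 * K + 4),
    show (K + 2).factorial = (K + 2) * (K + 1).factorial from Nat.factorial_succ (K + 1)]
  have := Nat.factorial_pos (K + 1)
  simp only [show K + 2 + 1 = K + 3 from rfl, show K + 2 + 2 = K + 4 from rfl]
  push_cast
  field_simp
  ring

lemma tendsto_r_pow_mul_primitive (hM : 0 < M) (hM' : M ≤ 1 / 8) (hr : IsSchwR M r) {K : ℕ}
    (hα : ContDiffOn ℝ (⊤ : ℕ∞) (fun p : ℝ × ℝ => α p.1 p.2) D)
    (hT : TeukEq M r α 2 (K + 2)) (hdata : PlusData M r α (K + 2) A B C ε C₀ C₁) {u : ℝ}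
    (hu : u ≤ -1) :
    Tendsto (fun v => r u v ^ (K + 4) *
        (wt M r u v ^ (K + 3) * AN M r (baseF r α 2) (K + 1) u v)) atTop
      (𝓝 (M * (aSeq (K + 2) K * A) * (-(dCoef K + eCoef K) * betaSeq (K + 4) (K + 2)
        + eCoef K / 2 * betaSeq (K + 4) (K + 1)))) := by
  set a := aSeq (K + 2) K * A with ha
  have hJ := (((tendsto_r_pow_mul_primJ hM hr hu (K + 4) (K + 2)).const_mul
    (-(dCoef K + eCoef K))).add ((tendsto_r_pow_mul_primJ hM hr hu (K + 4) (K + 1)).const_mul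
    (eCoef K / 2))).const_mul (M * a)
  have hinv : Tendsto (fun v => (r u v)⁻¹) atTop (𝓝 0) :=
    (tendsto_r_atTop hM hr hu).inv_tendsto_atTop
  have herr : Tendsto (fun v => r u v ^ (K + 4) *
      (wt M r u v ^ (K + 3) * AN M r (baseF r α 2) (K + 1) u v
        - M * a * (-(dCoef K + eCoef K) * primJ r (K + 4) (K + 2) u v
          + eCoef K / 2 * primJ r (K + 4) (K + 1) u v))) atTop (𝓝 0) := by
    rw [Metric.tendsto_nhds]
    intro δ hδ
    obtain ⟨c, hc, h⟩ := exists_abs_primitive_sub_le hM hM' hr hα hT hdata (half_pos hδ)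
    have hsmall : ∀ᶠ v in atTop, c * (r u v)⁻¹ < δ / 2 := by
      have := hinv.const_mul c
      rw [mul_zero] at this
      exact (tendsto_order.1 this).2 _ (half_pos hδ)
    filter_upwards [hsmall, eventually_ge_atTop 2] with v h1 hv
    have h2 := one_le_r hM hr hu (by linarith : (1 : ℝ) ≤ v)
    rw [dist_zero_right, norm_mul, norm_pow, Real.norm_of_nonneg (by linarith : 0 ≤ r u v),
      Real.norm_eq_abs]
    calc _ ≤ r u v ^ (K + 4) * (δ / 2 * (r u v ^ (K + 4))⁻¹ + c * (r u v ^ (K + 5))⁻¹) := by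
          gcongr
          exact h u v hu hv
      _ = δ / 2 + c * (r u v)⁻¹ := by field_simp; ring
      _ < δ := by linarith
  have := herr.add hJ
  rw [zero_add] at this
  refine this.congr fun v => ?_
  ring

lemma tendsto_zpow_mul_deriv_AN (hM : 0 < M) (hM' : M ≤ 1 / 8) (hr : IsSchwR M r) {K : ℕ}
    (hα : ContDiffOn ℝ (⊤ : ℕ∞) (fun p : ℝ × ℝ => α p.1 p.2) D)
    (hT : TeukEq M r α 2 (K + 2)) (hdata : PlusData M r α (K + 2) A B C ε C₀ C₁) {u : ℝ}
    (hu : u ≤ -1) :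
    Tendsto (fun v => (r u v ^ K)⁻¹ * deriv (AN M r (baseF r α 2) K u) v) atTop
      (𝓝 ((-1 : ℝ) ^ (K + 2 + 1) * (2 * (K.factorial : ℝ) * ((K + 2 + 1).factorial : ℝ) /
        ((K + 2 + 2).factorial : ℝ)) * M * A)) := by
  have hinv : Tendsto (fun v => (r u v)⁻¹) atTop (𝓝 0) :=
    (tendsto_r_atTop hM hr hu).inv_tendsto_atTop
  have hO : Tendsto (fun v => Om2 M r u v) atTop (𝓝 1) := by
    simpa [Om2, div_eq_mul_inv] using (hinv.const_mul (2 * M)).const_sub 1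
  have h := (tendsto_r_pow_mul_primitive hM hM' hr hα hT hdata hu).mul
    ((hO.pow (K + 2)).inv₀ (by norm_num))
  rw [limit_const_eq, one_pow, inv_one, mul_one] at h
  refine h.congr' ?_
  filter_upwards [eventually_gt_atTop 1] with v hv
  have h1 := one_le_r hM hr hu hv.le
  have h2 := Om2_lower hM hM' hr hu hv.le
  have h3 : Om2 M r u v ≠ 0 := by linarith
  rw [(hasDerivAt_AN_v hM hM' hr (smoothPos_baseF hr hα) K hu hv).deriv, wt, div_pow, ← pow_mul,
    show 2 * (K + 3) = K + (K + 4) + 2 by ring, pow_add, pow_add]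
  field_simp
  ring

end Limit

end SchwTeuk

/-- For a smooth solution of `T_{+2,ℓ}` with the `s = +2` scattering data and a priori
bounds, along every outgoing null line
`r^{2-ℓ}·∂_v A^{[+2],ℓ-2} → (-1)^{ℓ+1}·(2·(ℓ-2)!·(ℓ+1)!/(ℓ+2)!)·M·𝒜` as `v → ∞`. -/
theorem plus_top_transversal_derivative_limit (M : ℝ) (hM : 0 < M) (hM' : M ≤ 1 / 8)
    (r α : ℝ → ℝ → ℝ) (hr : IsSchwR M r) (ℓ : ℕ) (hℓ : 2 ≤ ℓ)
    (hα : ContDiffOn ℝ (⊤ : ℕ∞) (fun p : ℝ × ℝ => α p.1 p.2) D)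
    (hT : TeukEq M r α 2 ℓ)
    (A B C ε C₀ C₁ : ℝ) (hdata : PlusData M r α ℓ A B C ε C₀ C₁) :
    ∀ u : ℝ, u ≤ -1 →
      Tendsto (fun v => (r u v) ^ ((2 : ℤ) - (ℓ : ℤ)) *
          deriv (fun v' => AN M r (baseF r α 2) (ℓ - 2) u v') v) atTop
        (nhds ((-1 : ℝ) ^ (ℓ + 1) *
          (2 * (Nat.factorial (ℓ - 2) : ℝ) * (Nat.factorial (ℓ + 1) : ℝ) /
            (Nat.factorial (ℓ + 2) : ℝ)) * M * A)) := by
  intro u hu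
  obtain ⟨K, rfl⟩ := Nat.exists_eq_add_of_le' hℓ
  simp only [Nat.add_sub_cancel]
  refine (SchwTeuk.tendsto_zpow_mul_deriv_AN hM hM' hr hα hT hdata hu).congr fun v => ?_
  rw [show (2 : ℤ) - ((K + 2 : ℕ) : ℤ) = -(K : ℤ) by push_cast; ring, zpow_neg, zpow_natCast]
end
end

section
/- Let μ > 0 and let x : (−∞, 0] → ℝ³ \ {0} be a twice continuously differentiable solution of the Kepler equation ẍ(t) = −μ·x(t)/|x(t)|³ whose conserved energy E = ½|ẋ(t)|² − μ/|x(t)| is positive, and suppose |x(t)| → ∞ as t → −∞. Then there exist vectors v∞, b ∈ ℝ³ with |v∞| = √(2E) ≠ 0 such that, as t → −∞: ẋ(t) → v∞ and x(t) − v∞·t + (μ/|v∞|³)·v∞·log(−t) → b. In particular, the relative position vector of a hyperbolic Keplerian orbit has the asymptotic form x(t) = v·t + a·log|t| + b + o(1) as t → −∞, with a = −(μ/|v|³)·v, so |a| = μ/|v|². -/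
noncomputable section
open Real Set Filter

section KeplerAsymptotics

variable {F : Type*} [NormedAddCommGroup F]

theorem norm_sub_le_of_norm_hasDerivAt_le [NormedSpace ℝ F] {f f' : ℝ → F} {B B' : ℝ → ℝ} {S : ℝ}
    (hf : ∀ s, S ≤ s → HasDerivAt f (f' s) s) (hB : ∀ s, S ≤ s → HasDerivAt B (B' s) s)
    (h : ∀ s, S ≤ s → ‖f' s‖ ≤ B' s) {a b : ℝ} (ha : S ≤ a) (hab : a ≤ b) :
    ‖f b - f a‖ ≤ B b - B a := by
  have key := image_norm_le_of_norm_deriv_right_le_deriv_boundary' (a := a) (b := b)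
    (f := fun s => f s - f a) (f' := f') (B := fun s => B s - B a) (B' := B')
    (fun s hs => ((hf s (ha.trans hs.1)).sub_const _).continuousAt.continuousWithinAt)
    (fun s hs => ((hf s (ha.trans hs.1)).sub_const _).hasDerivWithinAt)
    (by simp)
    (fun s hs => ((hB s (ha.trans hs.1)).sub_const _).continuousAt.continuousWithinAt)
    (fun s hs => ((hB s (ha.trans hs.1)).sub_const _).hasDerivWithinAt)
    (fun s hs => h s (ha.trans hs.1))
  exact key ⟨hab, le_rfl⟩

theorem exists_tendsto_of_norm_hasDerivAt_le_rpow [NormedSpace ℝ F] [CompleteSpace F]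
    {f f' : ℝ → F} {S C p : ℝ} (hS : 0 < S) (hp : 0 < p)
    (hf : ∀ s, S ≤ s → HasDerivAt f (f' s) s)
    (h : ∀ s, S ≤ s → ‖f' s‖ ≤ C * s ^ (-p - 1)) :
    ∃ l, Tendsto f atTop (nhds l) ∧ ∀ s, S ≤ s → ‖f s - l‖ ≤ C / p * s ^ (-p) := by
  have hC : 0 ≤ C := nonneg_of_mul_nonneg_left ((norm_nonneg _).trans (h S le_rfl))
    (rpow_pos_of_pos hS _)
  have hB : ∀ s, S ≤ s → HasDerivAt (fun s : ℝ => -(C / p) * s ^ (-p)) (C * s ^ (-p - 1)) s := by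
    intro s hs
    have := (Real.hasDerivAt_rpow_const (x := s) (p := -p)
      (Or.inl (hS.trans_le hs).ne')).const_mul (-(C / p))
    refine this.congr_deriv ?_
    field_simp
  have hle : ∀ a b, S ≤ a → a ≤ b → ‖f b - f a‖ ≤ C / p * a ^ (-p) := by
    intro a b ha hab
    have h1 := norm_sub_le_of_norm_hasDerivAt_le hf hB h ha hab
    have h2 : 0 ≤ C / p * b ^ (-p) :=
      mul_nonneg (by positivity) (rpow_nonneg (hS.le.trans (ha.trans hab)) _)
    linarith
  have hlim : Tendsto (fun s : ℝ => C / p * s ^ (-p)) atTop (nhds 0) := by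
    simpa using (tendsto_rpow_neg_atTop hp).const_mul (C / p)
  have hcau : Cauchy (map f atTop) := by
    refine Metric.cauchy_iff.2 ⟨inferInstance, fun ε hε => ?_⟩
    obtain ⟨N, hN⟩ := eventually_atTop.1
      ((hlim.eventually_lt_const (half_pos hε)).and (eventually_ge_atTop S))
    obtain ⟨hN1, hN2⟩ := hN N le_rfl
    refine ⟨f '' Ici N, image_mem_map (Ici_mem_atTop N), ?_⟩
    rintro _ ⟨a, ha, rfl⟩ _ ⟨b, hb, rfl⟩
    have h1 := hle N a hN2 ha
    have h2 := hle N b hN2 hb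
    have := dist_triangle_right (f a) (f b) (f N)
    rw [dist_eq_norm (f a) (f N), dist_eq_norm (f b) (f N)] at this
    linarith
  obtain ⟨l, hl⟩ := CompleteSpace.complete hcau
  refine ⟨l, hl, fun s hs => ?_⟩
  have h1 : Tendsto (fun b => ‖f b - f s‖) atTop (nhds ‖l - f s‖) :=
    (Tendsto.sub_const hl _).norm
  rw [norm_sub_rev]
  exact le_of_tendsto h1 ((eventually_ge_atTop s).mono fun b hb => hle s b hs hb)

theorem norm_inv_cube_smul_sub_le [NormedSpace ℝ F] {a b : F} {m : ℝ} (hm : 0 < m)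
    (ha : m ≤ ‖a‖) (hb : m ≤ ‖b‖) :
    ‖(1 / ‖a‖ ^ 3) • a - (1 / ‖b‖ ^ 3) • b‖ ≤ 4 * ‖a - b‖ / m ^ 3 := by
  have ha' := hm.trans_le ha
  have hb' := hm.trans_le hb
  have e : (1 / ‖a‖ ^ 3) • a - (1 / ‖b‖ ^ 3) • b
      = (1 / ‖a‖ ^ 3) • (a - b) + (1 / ‖a‖ ^ 3 - 1 / ‖b‖ ^ 3) • b := by
    module
  have h3 : ∀ p q : ℝ, m ≤ p → m ≤ q → 1 / (p ^ 2 * q) ≤ 1 / m ^ 3 := by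
    intro p q hp hq
    apply one_div_le_one_div_of_le (by positivity)
    calc m ^ 3 = m ^ 2 * m := by ring
      _ ≤ p ^ 2 * q := by gcongr
  have e2 : (1 / ‖a‖ ^ 3 - 1 / ‖b‖ ^ 3) * ‖b‖ = (‖b‖ - ‖a‖) *
      (1 / (‖a‖ ^ 2 * ‖a‖) + 1 / (‖a‖ ^ 2 * ‖b‖) + 1 / (‖b‖ ^ 2 * ‖a‖)) := by
    field_simp
    ring
  have hd : |‖b‖ - ‖a‖| ≤ ‖a - b‖ := by
    rw [abs_sub_comm]; exact abs_norm_sub_norm_le a b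
  have t2 : ‖(1 / ‖a‖ ^ 3 - 1 / ‖b‖ ^ 3) • b‖ ≤ ‖a - b‖ * (3 * (1 / m ^ 3)) := by
    rw [norm_smul, Real.norm_eq_abs, ← abs_of_pos hb', ← abs_mul, abs_of_pos hb', e2, abs_mul,
      abs_of_nonneg (a := 1 / (‖a‖ ^ 2 * ‖a‖) + 1 / (‖a‖ ^ 2 * ‖b‖) + 1 / (‖b‖ ^ 2 * ‖a‖))
        (by positivity)]
    gcongr
    linarith [h3 _ _ ha ha, h3 _ _ ha hb, h3 _ _ hb ha]
  have t1 : ‖(1 / ‖a‖ ^ 3) • (a - b)‖ ≤ 1 / m ^ 3 * ‖a - b‖ := by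
    rw [norm_smul, Real.norm_of_nonneg (by positivity)]
    gcongr
  rw [e]
  calc _ ≤ _ := norm_add_le _ _
    _ ≤ 1 / m ^ 3 * ‖a - b‖ + ‖a - b‖ * (3 * (1 / m ^ 3)) := add_le_add t1 t2
    _ = _ := by ring

variable [InnerProductSpace ℝ F]

theorem kepler_exists_linear_lower_bound {μ E : ℝ} (hμ : 0 < μ) (hE : 0 < E) {y y' : ℝ → F}
    (hy : ∀ s, 0 < s → HasDerivAt y (y' s) s)
    (hy' : ∀ s, 0 < s → HasDerivAt y' ((-(μ / ‖y s‖ ^ 3)) • y s) s)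
    (hne : ∀ s, 0 < s → y s ≠ 0)
    (hen : ∀ s, 0 < s → (1 / 2) * ‖y' s‖ ^ 2 - μ / ‖y s‖ = E) :
    ∃ S, 1 ≤ S ∧ ∀ s, S ≤ s → √E * s ≤ ‖y s‖ := by
  have hd1 : ∀ s, 0 < s → HasDerivAt (fun s => ‖y s‖ ^ 2 - 2 * E * s ^ 2)
      (2 * inner ℝ (y s) (y' s) - 4 * E * s) s := by
    intro s hs
    refine ((hy s hs).norm_sq.sub ((hasDerivAt_pow 2 s).const_mul (2 * E))).congr_deriv ?_
    norm_num
    ring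
  have hd2 : ∀ s, 0 < s → HasDerivAt (fun s => 2 * inner ℝ (y s) (y' s) - 4 * E * s)
      (2 * (μ / ‖y s‖)) s := by
    intro s hs
    have hr : 0 < ‖y s‖ := norm_pos_iff.2 (hne s hs)
    refine ((((hy s hs).inner ℝ (hy' s hs)).const_mul 2).sub
      ((hasDerivAt_id s).const_mul (4 * E))).congr_deriv ?_
    rw [inner_smul_right, real_inner_self_eq_norm_sq, real_inner_self_eq_norm_sq, ← hen s hs]
    field_simp
    ring
  set A := 2 * inner ℝ (y 1) (y' 1) - 4 * E * 1 with hA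
  have hpos : ∀ s : ℝ, s ∈ Ici (1 : ℝ) → 0 < s := fun s hs => zero_lt_one.trans_le hs
  have m1 : MonotoneOn (fun s => 2 * inner ℝ (y s) (y' s) - 4 * E * s) (Ici 1) :=
    monotoneOn_of_hasDerivWithinAt_nonneg (convex_Ici 1)
      (fun s hs => (hd2 s (hpos s hs)).continuousAt.continuousWithinAt)
      (fun s hs => (hd2 s (hpos s (interior_subset hs))).hasDerivWithinAt)
      (fun s _ => by positivity)
  have m2 : MonotoneOn (fun s => ‖y s‖ ^ 2 - 2 * E * s ^ 2 - A * s) (Ici 1) :=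
    monotoneOn_of_hasDerivWithinAt_nonneg (convex_Ici 1)
      (fun s hs => ((hd1 s (hpos s hs)).sub
        ((hasDerivAt_id s).const_mul A)).continuousAt.continuousWithinAt)
      (fun s hs => ((hd1 s (hpos s (interior_subset hs))).sub
        ((hasDerivAt_id s).const_mul A)).hasDerivWithinAt)
      (fun s hs => by
        have := m1 self_mem_Ici (interior_subset hs) (interior_subset hs)
        simp only at this
        simp only [mul_one]
        linarith)
  set K := ‖y 1‖ ^ 2 - 2 * E * 1 ^ 2 - A * 1 with hK
  refine ⟨1 + (|A| + |K|) / E, by simpa using by positivity, fun s hs => ?_⟩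
  have h1 : 1 ≤ s := le_trans (by simpa using by positivity) hs
  have h2 : |A| + |K| ≤ E * s := by
    have : (|A| + |K|) / E ≤ s := by linarith
    rwa [div_le_iff₀ hE, mul_comm] at this
  have h3 := m2 self_mem_Ici h1 h1
  simp only at h3
  have h4 : E * s ^ 2 ≤ ‖y s‖ ^ 2 := by
    have a1 := neg_abs_le A
    have a2 := neg_abs_le K
    nlinarith [abs_nonneg A, abs_nonneg K]
  refine le_of_pow_le_pow_left₀ two_ne_zero (norm_nonneg _) ?_
  rwa [mul_pow, Real.sq_sqrt hE.le]

theorem kepler_future_asymptotics [CompleteSpace F] {μ E : ℝ} (hμ : 0 < μ) (hE : 0 < E)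
    {y y' : ℝ → F}
    (hy : ∀ s, 0 < s → HasDerivAt y (y' s) s)
    (hy' : ∀ s, 0 < s → HasDerivAt y' ((-(μ / ‖y s‖ ^ 3)) • y s) s)
    (hne : ∀ s, 0 < s → y s ≠ 0)
    (hen : ∀ s, 0 < s → (1 / 2) * ‖y' s‖ ^ 2 - μ / ‖y s‖ = E) :
    ∃ u b : F, ‖u‖ = √(2 * E) ∧ Tendsto y' atTop (nhds u) ∧
      Tendsto (fun s => y s - s • u - ((μ / ‖u‖ ^ 3) * Real.log s) • u) atTop (nhds b) := by
  obtain ⟨S, hS1, hlow⟩ := kepler_exists_linear_lower_bound hμ hE hy hy' hne hen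
  have hS : 0 < S := zero_lt_one.trans_le hS1
  have hc : 0 < √E := Real.sqrt_pos.2 hE
  have hpos : ∀ s, S ≤ s → 0 < s := fun s hs => hS.trans_le hs
  obtain ⟨u, hu, hu1⟩ := exists_tendsto_of_norm_hasDerivAt_le_rpow (f := y') (C := μ / E)
    hS one_pos (fun s hs => hy' s (hpos s hs)) (fun s hs => by
      have hs0 := hpos s hs
      have hr : 0 < ‖y s‖ := norm_pos_iff.2 (hne s hs0)
      have hE2 : E * s ^ 2 ≤ ‖y s‖ ^ 2 := by
        calc E * s ^ 2 = (√E * s) ^ 2 := by rw [mul_pow, Real.sq_sqrt hE.le]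
          _ ≤ _ := by gcongr; exact hlow s hs
      rw [norm_smul, norm_neg, Real.norm_of_nonneg (by positivity),
        show (-1 - 1 : ℝ) = -(2 : ℕ) by norm_num, rpow_neg hs0.le, rpow_natCast]
      calc μ / ‖y s‖ ^ 3 * ‖y s‖ = μ / ‖y s‖ ^ 2 := by field_simp
        _ ≤ μ / (E * s ^ 2) := by gcongr
        _ = _ := by field_simp)
  have hr : Tendsto (fun s => ‖y s‖) atTop atTop :=
    tendsto_atTop_mono' _ ((eventually_ge_atTop S).mono hlow) (tendsto_id.const_mul_atTop hc)
  have hnu : ‖u‖ = √(2 * E) := by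
    have h1 : Tendsto (fun s => ‖y' s‖ ^ 2) atTop (nhds (2 * E + 0)) := by
      refine Tendsto.congr' ?_ (((hr.const_div_atTop (2 * μ))).const_add (2 * E))
      filter_upwards [eventually_gt_atTop 0] with s hs
      rw [← hen s hs]; ring
    have h2 := tendsto_nhds_unique h1 (hu.norm.pow 2)
    rw [← add_zero (2 * E), h2, Real.sqrt_sq (norm_nonneg _)]
  have hu0 : √E ≤ ‖u‖ := by rw [hnu]; exact Real.sqrt_le_sqrt (by linarith)
  have hupos : 0 < ‖u‖ := hc.trans_le hu0
  -- the deviation from uniform motion grows at most like `√s`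
  obtain ⟨D, hD⟩ : ∃ D, ∀ s, S ≤ s → ‖y s - s • u‖ ≤ D * s ^ (1 / 2 : ℝ) := by
    have hB : ∀ s, S ≤ s → HasDerivAt (fun s : ℝ => 2 * (μ / E) * s ^ (1 / 2 : ℝ))
        (μ / E * s ^ (1 / 2 - 1 : ℝ)) s := fun s hs => by
      refine ((Real.hasDerivAt_rpow_const (x := s) (p := 1 / 2)
        (Or.inl (hpos s hs).ne')).const_mul (2 * (μ / E))).congr_deriv ?_
      ring
    have hf : ∀ s, S ≤ s → HasDerivAt (fun s => y s - s • u) (y' s - u) s := fun s hs => by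
      exact ((hy s (hpos s hs)).sub ((hasDerivAt_id s).smul_const u)).congr_deriv (by simp)
    have hb : ∀ s, S ≤ s → ‖y' s - u‖ ≤ μ / E * s ^ (1 / 2 - 1 : ℝ) := fun s hs => by
      refine (hu1 s hs).trans ?_
      rw [div_one]
      gcongr
      · exact hS1.trans hs
      · norm_num
    refine ⟨2 * (μ / E) + ‖y S - S • u‖, fun s hs => ?_⟩
    have h1 := norm_sub_le_of_norm_hasDerivAt_le hf hB hb le_rfl hs
    have h2 : 0 ≤ 2 * (μ / E) * S ^ (1 / 2 : ℝ) := by positivity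
    have h3 : ‖y s - s • u‖ ≤ ‖y s - s • u - (y S - S • u)‖ + ‖y S - S • u‖ := by
      simpa using norm_add_le (y s - s • u - (y S - S • u)) (y S - S • u)
    have h4 : (1 : ℝ) ≤ s ^ (1 / 2 : ℝ) := one_le_rpow (hS1.trans hs) (by norm_num)
    nlinarith [norm_nonneg (y S - S • u)]
  set k := μ / ‖u‖ ^ 3 with hk
  have hw' : ∀ s, S ≤ s → HasDerivAt (fun s => y' s - u - (k * s⁻¹) • u)
      ((-(μ / ‖y s‖ ^ 3)) • y s + (k / s ^ 2) • u) s := fun s hs => by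
    refine (((hy' s (hpos s hs)).sub_const u).sub
      (((hasDerivAt_inv (hpos s hs).ne').const_mul k).smul_const u)).congr_deriv ?_
    module
  have hw'' : ∀ s, S ≤ s → ‖(-(μ / ‖y s‖ ^ 3)) • y s + (k / s ^ 2) • u‖ ≤
      (μ * (4 * D / √E ^ 3)) * s ^ (-(3 / 2) - 1 : ℝ) := fun s hs => by
    have hs0 := hpos s hs
    have e1 : (-(μ / ‖y s‖ ^ 3)) • y s + (k / s ^ 2) • u =
        (-μ) • ((1 / ‖y s‖ ^ 3) • y s - (1 / ‖s • u‖ ^ 3) • s • u) := by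
      rw [norm_smul, Real.norm_of_nonneg hs0.le, hk, smul_sub, smul_smul, smul_smul, smul_smul,
        sub_eq_add_neg, ← neg_smul]
      congr 2
      · ring
      · field_simp
    have h1 : √E * s ≤ ‖s • u‖ := by
      rw [norm_smul, Real.norm_of_nonneg hs0.le, mul_comm]
      gcongr
    have h2 := norm_inv_cube_smul_sub_le (mul_pos hc hs0) (hlow s hs) h1
    have e2 : s ^ (-(3 / 2) - 1 : ℝ) = s ^ (1 / 2 : ℝ) / s ^ 3 := by
      rw [← rpow_natCast, ← rpow_sub hs0]
      norm_num
    rw [e1, norm_smul, norm_neg, Real.norm_of_nonneg hμ.le, mul_assoc]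
    gcongr
    calc _ ≤ _ := h2
      _ ≤ 4 * (D * s ^ (1 / 2 : ℝ)) / (√E * s) ^ 3 := by gcongr; exact hD s hs
      _ = _ := by rw [e2]; field_simp
  obtain ⟨l, hl, hl1⟩ := exists_tendsto_of_norm_hasDerivAt_le_rpow hS (by norm_num) hw' hw''
  have hl0 : l = 0 := by
    refine tendsto_nhds_unique hl ?_
    simpa using (hu.sub_const u).sub
      ((tendsto_inv_atTop_zero.const_mul k).smul_const u)
  subst hl0
  have hw : ∀ s, S ≤ s → HasDerivAt (fun s => y s - s • u - (k * Real.log s) • u)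
      (y' s - u - (k * s⁻¹) • u) s := fun s hs => by
    exact (((hy s (hpos s hs)).sub ((hasDerivAt_id s).smul_const u)).sub
      (((Real.hasDerivAt_log (hpos s hs).ne').const_mul k).smul_const u)).congr_deriv (by simp)
  obtain ⟨b, hb, -⟩ := exists_tendsto_of_norm_hasDerivAt_le_rpow (p := 1 / 2) hS (by norm_num) hw
    (fun s hs => by
      have := hl1 s hs
      rw [sub_zero] at this
      convert this using 3
      norm_num)
  exact ⟨u, b, hnu, hu, hb⟩

end KeplerAsymptotics

/-- Asymptotics of hyperbolic Keplerian orbits in the infinite past: a C² solution of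
`ẍ = −μx/|x|³` on `(−∞,0]` with positive conserved energy `E` and `|x(t)| → ∞` as
`t → −∞` satisfies `ẋ(t) → vlim` with `|vlim| = √(2E) ≠ 0` and
`x(t) − vlim·t + (μ/|vlim|³)·log(−t)·vlim → b`, i.e. `x(t) = v·t + a·log|t| + b + o(1)` with
`a = −(μ/|v|³)·v`, `|a| = μ/|v|²`. -/
theorem hyperbolic_kepler_past_asymptotics (μ : ℝ) (hμ : 0 < μ)
    (x : ℝ → EuclideanSpace ℝ (Fin 3))
    (hx : ContDiffOn ℝ 2 x (Iic 0))
    (hne : ∀ t : ℝ, t ≤ 0 → x t ≠ 0)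
    (hODE : ∀ t : ℝ, t ≤ 0 → deriv (deriv x) t = (-(μ / ‖x t‖ ^ 3)) • x t)
    (E : ℝ) (hEpos : 0 < E)
    (hE : ∀ t : ℝ, t ≤ 0 → (1 / 2) * ‖deriv x t‖ ^ 2 - μ / ‖x t‖ = E)
    (hinf : Tendsto (fun t => ‖x t‖) atBot atTop) :
    ∃ vlim b : EuclideanSpace ℝ (Fin 3),
      ‖vlim‖ = Real.sqrt (2 * E) ∧ vlim ≠ 0 ∧
      Tendsto (fun t => deriv x t) atBot (nhds vlim) ∧
      Tendsto (fun t => x t - t • vlim + ((μ / ‖vlim‖ ^ 3) * Real.log (-t)) • vlim) atBot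
        (nhds b) ∧
      ‖(μ / ‖vlim‖ ^ 3) • vlim‖ = μ / ‖vlim‖ ^ 2 := by
  have hd : ∀ t < 0, ContDiffAt ℝ 2 x t := fun t ht => hx.contDiffAt (Iic_mem_nhds ht)
  have hy : ∀ s : ℝ, 0 < s → HasDerivAt (fun s => x (-s)) (-deriv x (-s)) s := fun s hs => by
    have h := ((hd (-s) (neg_lt_zero.2 hs)).differentiableAt (by norm_num)).hasDerivAt
    exact (h.scomp s (hasDerivAt_neg s)).congr_deriv (by simp)
  have hy' : ∀ s : ℝ, 0 < s → HasDerivAt (fun s => -deriv x (-s))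
      ((-(μ / ‖x (-s)‖ ^ 3)) • x (-s)) s := fun s hs => by
    have h0 : ContDiffAt ℝ 1 (deriv x) (-s) :=
      (hd (-s) (neg_lt_zero.2 hs)).derivWithin (by norm_num)
    have h := (h0.differentiableAt (by norm_num)).hasDerivAt
    rw [hODE (-s) (neg_nonpos.2 hs.le)] at h
    exact (h.scomp s (hasDerivAt_neg s)).neg.congr_deriv (by simp)
  obtain ⟨u, b, hu, hu1, hb⟩ := kepler_future_asymptotics hμ hEpos hy hy'
    (fun s hs => hne (-s) (neg_nonpos.2 hs.le))
    (fun s hs => by rw [norm_neg]; exact hE (-s) (neg_nonpos.2 hs.le))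
  have hupos : 0 < ‖u‖ := by rw [hu]; positivity
  refine ⟨-u, b, by rw [norm_neg, hu], neg_ne_zero.2 (norm_pos_iff.1 hupos), ?_, ?_, ?_⟩
  · simpa [Function.comp_def] using (hu1.comp tendsto_neg_atBot_atTop).neg
  · refine (hb.comp tendsto_neg_atBot_atTop).congr fun t => ?_
    simp only [Function.comp_apply, neg_neg, norm_neg]
    module
  · rw [norm_smul, norm_neg, Real.norm_of_nonneg (by positivity)]
    field_simp
end
end

section
/- Fix an integer ℓ ≥ 2 and v* ∈ ℝ, and for u < v* set r := (v* − u)/2 and ψ₄(u) := r^{ℓ−2} · (d/du)^{ℓ+2} ( f(u)·r^{1−ℓ} ) (derivatives taken along the ingoing null cone v = v*, where dr/du = −1/2). Then: (a) if f(u) = c₀·u^ℓ for a constant c₀ ∈ ℝ, then r⁵·ψ₄(u) remains bounded as u → −∞ (i.e. ψ₄ = O(r⁻⁵), the peeling rate); (b) if f(u) = c₁·u^{ℓ−1}·log(−u) for a constant c₁ ∈ ℝ (u < 0), then lim_{u→−∞} r⁴·ψ₄(u) = ( (−1)^ℓ·(ℓ+1)!/8 )·c₁. In particular, for the log-corrected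 multipole moments of hyperbolic Keplerian orbits the extremal Weyl component Ψ₄ decays only like r⁻⁴ towards past null infinity, violating peeling, with coefficient proportional to c₁. -/
noncomputable section
open Real Set Filter

/-- Iterated derivatives of a power of the radius `r = (v - w) / 2` along an ingoing cone. -/
lemma iteratedDeriv_radius_zpow (v : ℝ) (m : ℤ) (n : ℕ) (u : ℝ) :
    iteratedDeriv n (fun w => ((v - w) / 2) ^ m) u =
      (-1 / 2) ^ n * (∏ i ∈ Finset.range n, ((m : ℝ) - i)) * ((v - u) / 2) ^ (m - n) := by
  have h : (fun w : ℝ => ((v - w) / 2) ^ m) = fun w => (fun x : ℝ => x ^ m) (v - w) / 2 ^ m := by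
    funext w
    simp [div_zpow]
  rw [h, iteratedDeriv_div_const, iteratedDeriv_comp_const_sub (f := fun x : ℝ => x ^ m)]
  simp only [iteratedDeriv_eq_iterate, iter_deriv_zpow, smul_eq_mul, div_zpow,
    zpow_sub₀ (two_ne_zero : (2 : ℝ) ≠ 0), zpow_natCast, div_pow]
  field_simp

lemma contDiffAt_radius_zpow {v u : ℝ} (hu : u < v) (m : ℤ) (n : ℕ) :
    ContDiffAt ℝ n (fun w => ((v - w) / 2) ^ m) u := by
  have h : AnalyticAt ℝ (fun w : ℝ => (v - w) / 2) u := by fun_prop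
  exact (h.fun_zpow (n := m) (by simp only [ne_eq]; linarith)).contDiffAt

lemma contDiffAt_log_neg {u : ℝ} (hu : u ≠ 0) (n : ℕ) :
    ContDiffAt ℝ n (fun w => Real.log (-w)) u := by
  simpa using (Real.contDiffAt_log (n := n)).2 hu

lemma iteratedDeriv_succ_log_neg (n : ℕ) (u : ℝ) :
    iteratedDeriv (n + 1) (fun w => Real.log (-w)) u =
      (-1) ^ n * (n.factorial : ℝ) * (u ^ (n + 1))⁻¹ := by
  simp only [Real.log_neg_eq_log]
  rw [iteratedDeriv_succ', Real.deriv_log', iteratedDeriv_eq_iterate, iter_deriv_inv,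
    ← zpow_natCast u, ← zpow_neg]
  congr 2
  push_cast
  ring

lemma tendsto_radius_atBot (v : ℝ) : Tendsto (fun u : ℝ => (v - u) / 2) atBot atTop :=
  (tendsto_atTop_add_const_left _ v tendsto_neg_atBot_atTop).atTop_div_const two_pos

lemma tendsto_radius_div_atBot (v : ℝ) :
    Tendsto (fun u : ℝ => (v - u) / 2 / u) atBot (nhds (-1 / 2)) := by
  have h : Tendsto (fun u : ℝ => v / 2 * u⁻¹ - 1 / 2) atBot (nhds (v / 2 * 0 - 1 / 2)) :=
    (tendsto_inv_atBot_zero.const_mul _).sub_const _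
  refine (h.congr' ?_).trans_eq (by norm_num)
  filter_upwards [eventually_lt_atBot 0] with u hu
  field_simp [hu.ne]

lemma tendsto_radius_pow_mul_iteratedDeriv_log_neg (v : ℝ) (n : ℕ) :
    Tendsto (fun u : ℝ => ((v - u) / 2) ^ (n + 1) *
        iteratedDeriv (n + 1) (fun w => Real.log (-w)) u) atBot
      (nhds ((-1) ^ n * (n.factorial : ℝ) * (-1 / 2) ^ (n + 1))) := by
  refine (((tendsto_radius_div_atBot v).pow (n + 1)).const_mul
    ((-1) ^ n * (n.factorial : ℝ))).congr fun u => ?_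
  rw [iteratedDeriv_succ_log_neg, div_pow]
  ring

lemma tendsto_inv_radius_atBot (v : ℝ) :
    Tendsto (fun u : ℝ => ((v - u) / 2)⁻¹) atBot (nhds 0) :=
  tendsto_inv_atTop_zero.comp (tendsto_radius_atBot v)

lemma tendsto_inv_radius_mul_log_neg (v : ℝ) :
    Tendsto (fun u : ℝ => ((v - u) / 2)⁻¹ * Real.log (-u)) atBot (nhds 0) := by
  have hlog : Tendsto (fun u : ℝ => Real.log (-u) / -u) atBot (nhds 0) :=
    Real.isLittleO_log_id_atTop.tendsto_div_nhds_zero.comp tendsto_neg_atBot_atTop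
  have hr := ((tendsto_radius_div_atBot v).inv₀ (by norm_num)).neg
  refine ((hr.mul hlog).congr' ?_).trans_eq (by simp)
  filter_upwards [eventually_lt_atBot 0, eventually_lt_atBot v] with u hu huv
  have : v - u ≠ 0 := by linarith
  have : u ≠ 0 := hu.ne
  field_simp

lemma tendsto_inv_radius_pow_mul_iteratedDeriv_log_neg (v : ℝ) {k : ℕ} (hk : k ≠ 0) (n : ℕ) :
    Tendsto (fun u : ℝ => ((v - u) / 2)⁻¹ ^ k * (((v - u) / 2) ^ n *
        iteratedDeriv n (fun w => Real.log (-w)) u)) atBot (nhds 0) := by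
  obtain ⟨k, rfl⟩ := Nat.exists_eq_succ_of_ne_zero hk
  rcases n with _ | n
  · refine ((((tendsto_inv_radius_atBot v).pow k).mul
      (tendsto_inv_radius_mul_log_neg v)).congr fun u => ?_).trans_eq (by simp)
    simp only [iteratedDeriv_zero, pow_zero, pow_succ]
    ring
  · exact (((tendsto_inv_radius_atBot v).pow (k + 1)).mul
      (tendsto_radius_pow_mul_iteratedDeriv_log_neg v n)).trans_eq (by simp)

lemma tendsto_radius_pow_mul_iteratedDeriv_zpow_mul_log_neg (v : ℝ) {k : ℕ} (hk : k ≠ 0) (n : ℕ) :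
    Tendsto (fun u : ℝ => ((v - u) / 2) ^ n *
        iteratedDeriv n (fun w => ((v - w) / 2) ^ (-(k : ℤ)) * Real.log (-w)) u)
      atBot (nhds 0) := by
  have hsum : Tendsto (fun u : ℝ => ∑ i ∈ Finset.range (n + 1),
      (n.choose i * ((-1 / 2) ^ i * ∏ j ∈ Finset.range i, (((-(k : ℤ) : ℤ) : ℝ) - j))) *
        (((v - u) / 2)⁻¹ ^ k * (((v - u) / 2) ^ (n - i) *
          iteratedDeriv (n - i) (fun w => Real.log (-w)) u))) atBot (nhds 0) := by
    refine (tendsto_finsetSum _ fun i _ =>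
      (tendsto_inv_radius_pow_mul_iteratedDeriv_log_neg v hk (n - i)).const_mul _).trans_eq ?_
    simp
  refine hsum.congr' ?_
  filter_upwards [eventually_lt_atBot 0, eventually_lt_atBot v] with u hu huv
  rw [iteratedDeriv_fun_mul (contDiffAt_radius_zpow huv _ n) (contDiffAt_log_neg hu.ne n),
    Finset.mul_sum]
  refine Finset.sum_congr rfl fun i hi => ?_
  have hr : (v - u) / 2 ≠ 0 := by linarith
  rw [iteratedDeriv_radius_zpow, zpow_sub₀ hr, zpow_neg, zpow_natCast, zpow_natCast, inv_pow,
    ← Nat.add_sub_of_le (Finset.mem_range_succ_iff.1 hi), Nat.add_sub_cancel_left, pow_add]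
  field_simp

/-- Expansion of `(w / r) ^ n` in inverse powers of the radius `r = (v - w) / 2`. -/
lemma pow_mul_radius_zpow_neg {v w : ℝ} (hw : w ≠ v) (n : ℕ) :
    w ^ n * ((v - w) / 2) ^ (-(n : ℤ)) =
      ∑ k ∈ Finset.range (n + 1),
        v ^ k * (-2) ^ (n - k) * n.choose k * ((v - w) / 2) ^ (-(k : ℤ)) := by
  have hr : v - w ≠ 0 := sub_ne_zero.2 hw.symm
  have h : w * ((v - w) / 2)⁻¹ = v * ((v - w) / 2)⁻¹ + -2 := by
    field_simp
    ring
  rw [zpow_neg, zpow_natCast, ← inv_pow, ← mul_pow, h, add_pow]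
  refine Finset.sum_congr rfl fun k _ => ?_
  rw [zpow_neg, zpow_natCast, mul_pow, inv_pow]
  ring

lemma iteratedDeriv_pow_mul_radius_zpow {v u : ℝ} (hu : u < v) (c : ℝ) (ℓ n : ℕ) :
    iteratedDeriv n (fun w => c * w ^ ℓ * ((v - w) / 2) ^ (1 - (ℓ : ℤ))) u =
      ∑ k ∈ Finset.range (ℓ + 1), c * (v ^ k * (-2) ^ (ℓ - k) * ℓ.choose k) *
        iteratedDeriv n (fun w => ((v - w) / 2) ^ (1 - (k : ℤ))) u := by
  have h : (fun w => c * w ^ ℓ * ((v - w) / 2) ^ (1 - (ℓ : ℤ))) =ᶠ[nhds u]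
      fun w => ∑ k ∈ Finset.range (ℓ + 1), c * (v ^ k * (-2) ^ (ℓ - k) * ℓ.choose k) *
        ((v - w) / 2) ^ (1 - (k : ℤ)) := by
    filter_upwards [eventually_lt_nhds hu] with w hw
    have hr : (v - w) / 2 ≠ 0 := by linarith
    simp only [sub_eq_add_neg (1 : ℤ), zpow_add₀ hr, zpow_one]
    calc _ = c * (w ^ ℓ * ((v - w) / 2) ^ (-(ℓ : ℤ))) * ((v - w) / 2) := by ring
      _ = _ := by
        rw [pow_mul_radius_zpow_neg hw.ne, Finset.mul_sum, Finset.sum_mul]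
        exact Finset.sum_congr rfl fun k _ => by ring
  rw [h.iteratedDeriv_eq, iteratedDeriv_fun_sum
    fun k _ => contDiffAt_const.mul (contDiffAt_radius_zpow hu _ n)]
  simp only [iteratedDeriv_const_mul_field]

lemma iteratedDeriv_pow_mul_log_neg_mul_radius_zpow {v u : ℝ} (hu : u < v) (hu₀ : u ≠ 0)
    (c : ℝ) (m n : ℕ) :
    iteratedDeriv n (fun w => c * w ^ m * Real.log (-w) * ((v - w) / 2) ^ (-(m : ℤ))) u =
      ∑ k ∈ Finset.range (m + 1), c * (v ^ k * (-2) ^ (m - k) * m.choose k) *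
        iteratedDeriv n (fun w => ((v - w) / 2) ^ (-(k : ℤ)) * Real.log (-w)) u := by
  have h : (fun w => c * w ^ m * Real.log (-w) * ((v - w) / 2) ^ (-(m : ℤ))) =ᶠ[nhds u]
      fun w => ∑ k ∈ Finset.range (m + 1), c * (v ^ k * (-2) ^ (m - k) * m.choose k) *
        (((v - w) / 2) ^ (-(k : ℤ)) * Real.log (-w)) := by
    filter_upwards [eventually_lt_nhds hu] with w hw
    calc _ = c * (w ^ m * ((v - w) / 2) ^ (-(m : ℤ))) * Real.log (-w) := by ring
      _ = _ := by
        rw [pow_mul_radius_zpow_neg hw.ne, Finset.mul_sum, Finset.sum_mul]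
        exact Finset.sum_congr rfl fun k _ => by ring
  rw [h.iteratedDeriv_eq, iteratedDeriv_fun_sum fun k _ => contDiffAt_const.mul
    ((contDiffAt_radius_zpow hu _ n).mul (contDiffAt_log_neg hu₀ n))]
  simp only [iteratedDeriv_const_mul_field]

/-- Powers `r ^ (1 - k)` of the radius lose their non-decaying parts under enough derivatives. -/
lemma abs_radius_pow_mul_iteratedDeriv_le {v u : ℝ} (hu : u ≤ v - 2) {n : ℕ} (hn : 2 ≤ n) (k : ℕ) :
    |((v - u) / 2) ^ (n + 1) * iteratedDeriv n (fun w => ((v - w) / 2) ^ (1 - (k : ℤ))) u| ≤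
      |(-1 / 2) ^ n * ∏ i ∈ Finset.range n, (((1 - (k : ℤ) : ℤ) : ℝ) - i)| := by
  have hr : 1 ≤ (v - u) / 2 := by linarith
  have hr₀ : (v - u) / 2 ≠ 0 := by positivity
  rw [iteratedDeriv_radius_zpow]
  rcases lt_or_ge k 2 with hk | hk
  · have h : ∏ i ∈ Finset.range n, (((1 - (k : ℤ) : ℤ) : ℝ) - i) = 0 := by
      refine Finset.prod_eq_zero (i := 1 - k) (Finset.mem_range.2 (by omega)) ?_
      push_cast [Nat.cast_sub (show k ≤ 1 by omega)]
      ring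
    rw [h]
    simp
  · have h : ((v - u) / 2) ^ (n + 1) * ((v - u) / 2) ^ (1 - (k : ℤ) - n) =
        (((v - u) / 2) ^ (k - 2))⁻¹ := by
      rw [← zpow_natCast, ← zpow_natCast, ← zpow_add₀ hr₀, ← zpow_neg]
      congr 1
      push_cast [Nat.cast_sub hk]
      ring
    rw [mul_left_comm, h, abs_mul]
    refine mul_le_of_le_one_right (abs_nonneg _) ?_
    rw [abs_of_nonneg (by positivity)]
    exact inv_le_one_of_one_le₀ (one_le_pow₀ hr)

/-- Minkowskian multipole-wave profiles along an ingoing cone `v = v*` with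
`r = (v* − u)/2` and `ψ₄(u) = r^{ℓ−2}·∂_u^{ℓ+2}(f(u)·r^{1−ℓ})`:
(a) for `f(u) = c₀·u^ℓ`, `r⁵·ψ₄` remains bounded as `u → −∞` (the peeling rate);
(b) for `f(u) = c₁·u^{ℓ−1}·log(−u)`, `r⁴·ψ₄(u) → ((−1)^ℓ·(ℓ+1)!/8)·c₁`, so peeling
fails at the `r⁻⁴` level. -/
theorem psi4_profile_peeling_failure (ℓ : ℕ) (hℓ : 2 ≤ ℓ) (vstar : ℝ) :
    (∀ c₀ : ℝ, ∃ C T : ℝ, T < vstar ∧ ∀ u : ℝ, u ≤ T →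
      |((vstar - u) / 2) ^ (5 : ℕ) * (((vstar - u) / 2) ^ ((ℓ : ℤ) - 2) *
          iteratedDeriv (ℓ + 2)
            (fun w => c₀ * w ^ ℓ * ((vstar - w) / 2) ^ (1 - (ℓ : ℤ))) u)| ≤ C) ∧
    (∀ c₁ : ℝ,
      Tendsto (fun u => ((vstar - u) / 2) ^ (4 : ℕ) * (((vstar - u) / 2) ^ ((ℓ : ℤ) - 2) *
          iteratedDeriv (ℓ + 2)
            (fun w => c₁ * w ^ (ℓ - 1) * Real.log (-w) * ((vstar - w) / 2) ^ (1 - (ℓ : ℤ)))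
            u)) atBot
        (nhds ((-1 : ℝ) ^ ℓ * (Nat.factorial (ℓ + 1) : ℝ) / 8 * c₁))) := by
  have hpow : ∀ {u : ℝ}, u < vstar → ∀ a b : ℕ, 2 ≤ a →
      ∀ x : ℝ, ((vstar - u) / 2) ^ a * (((vstar - u) / 2) ^ ((b : ℤ) - 2) * x) =
        ((vstar - u) / 2) ^ (a + b - 2) * x := by
    intro u hu a b ha x
    have hr : (vstar - u) / 2 ≠ 0 := by linarith
    rw [← mul_assoc, ← zpow_natCast, ← zpow_natCast, ← zpow_add₀ hr]
    congr 2
    push_cast [Nat.cast_sub (show 2 ≤ a + b by omega)]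
    ring
  refine ⟨fun c₀ => ?_, fun c₁ => ?_⟩
  · refine ⟨∑ k ∈ Finset.range (ℓ + 1), |c₀ * (vstar ^ k * (-2) ^ (ℓ - k) * ℓ.choose k)| *
      |(-1 / 2) ^ (ℓ + 2) * ∏ i ∈ Finset.range (ℓ + 2), (((1 - (k : ℤ) : ℤ) : ℝ) - i)|,
      vstar - 2, by linarith, fun u hu => ?_⟩
    have huv : u < vstar := by linarith
    rw [hpow huv 5 ℓ (by norm_num), show 5 + ℓ - 2 = ℓ + 2 + 1 by omega,
      iteratedDeriv_pow_mul_radius_zpow huv, Finset.mul_sum]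
    refine (Finset.abs_sum_le_sum_abs _ _).trans (Finset.sum_le_sum fun k _ => ?_)
    rw [mul_left_comm, abs_mul]
    refine mul_le_mul_of_nonneg_left ?_ (abs_nonneg _)
    exact abs_radius_pow_mul_iteratedDeriv_le hu (by omega) k
  · obtain ⟨m, rfl⟩ : ∃ m, ℓ = m + 1 := ⟨ℓ - 1, by omega⟩
    have hlim : Tendsto (fun u => ∑ k ∈ Finset.range (m + 1),
        c₁ * (vstar ^ k * (-2) ^ (m - k) * m.choose k) * (((vstar - u) / 2) ^ (m + 3) *
          iteratedDeriv (m + 3) (fun w => ((vstar - w) / 2) ^ (-(k : ℤ)) * Real.log (-w)) u))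
        atBot (nhds (c₁ * (-2) ^ m *
          ((-1) ^ (m + 2) * ((m + 2).factorial : ℝ) * (-1 / 2) ^ (m + 3)))) := by
      simp only [Finset.sum_range_succ']
      rw [← zero_add (c₁ * _ * _)]
      refine Tendsto.add ?_ ?_
      · refine (tendsto_finsetSum _ fun k _ =>
          (tendsto_radius_pow_mul_iteratedDeriv_zpow_mul_log_neg vstar
            k.succ_ne_zero (m + 3)).const_mul _).trans_eq ?_
        simp
      · simpa using (tendsto_radius_pow_mul_iteratedDeriv_log_neg vstar (m + 2)).const_mul
          (c₁ * (-2) ^ m)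
    have hval : c₁ * (-2 : ℝ) ^ m * ((-1) ^ (m + 2) * ((m + 2).factorial : ℝ) * (-1 / 2) ^ (m + 3)) =
        (-1 : ℝ) ^ (m + 1) * ((m + 1 + 1).factorial : ℝ) / 8 * c₁ := by
      have h : (-2 : ℝ) ^ m * (-1 / 2) ^ m = 1 := by
        rw [← mul_pow]
        norm_num
      linear_combination (-1 / 8) * (-1) ^ m * c₁ * ((m + 2).factorial : ℝ) * h
    rw [← hval]
    refine hlim.congr' ?_
    filter_upwards [eventually_lt_atBot 0, eventually_lt_atBot vstar] with u hu huv
    rw [hpow huv 4 (m + 1) (by norm_num), show 4 + (m + 1) - 2 = m + 3 by omega,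
      show (1 : ℤ) - ((m + 1 : ℕ) : ℤ) = -(m : ℤ) by push_cast; ring, Nat.add_sub_cancel,
      iteratedDeriv_pow_mul_log_neg_mul_radius_zpow huv hu.ne, Finset.mul_sum]
    exact Finset.sum_congr rfl fun k _ => by ring
end
end

section
/- Fix an integer ℓ ≥ 2 and v* ∈ ℝ, and for u < v* set r := (v* − u)/2 and ψ₀(u) := r^{ℓ−2} · (d/du)^{ℓ−2} ( f(u)·r^{−ℓ−3} ) (derivatives taken along the ingoing null cone v = v*, where dr/du = −1/2). If f(u) = c₀·u^ℓ for a constant c₀ ∈ ℝ, then lim_{u→−∞} r³·ψ₀(u) = (−1)^ℓ·2·ℓ!·c₀. In particular, for multipole moments growing like u^ℓ the extremal Weyl component Ψ₀ decays exactly like r⁻³ towards past null infinity, with nonzero limit of r³·Ψ₀ whenever c₀ ≠ 0. -/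
noncomputable section
open Real Set Filter

/-- The retarded-time derivative of `r ^ m`, where `r = (v - u) / 2`. -/
theorem hasDerivAt_radius_zpow (v : ℝ) (m : ℤ) {u : ℝ} (hu : u < v) :
    HasDerivAt (fun w => ((v - w) / 2) ^ m) (-(m : ℝ) / 2 * ((v - u) / 2) ^ (m - 1)) u := by
  have hr : (v - u) / 2 ≠ 0 := by linarith
  have h := (hasDerivAt_zpow m _ (Or.inl hr)).comp u
    (((hasDerivAt_id u).const_sub v).div_const 2)
  exact h.congr_deriv (by ring)

/-- Iterated derivatives of a finite sum of inverse powers of `r = (v - u) / 2` on `u < v`. -/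
theorem iteratedDeriv_sum_radius_zpow (v : ℝ) (F : ℝ → ℝ) (a : ℕ → ℝ) (N : ℕ)
    (hF : ∀ w < v, F w = ∑ k ∈ Finset.range N, a k * ((v - w) / 2) ^ (-(k : ℤ) - 3))
    (n : ℕ) : ∀ u < v, iteratedDeriv n F u = ∑ k ∈ Finset.range N,
      a k * (((k + 2 + n).factorial : ℝ) / ((k + 2).factorial * 2 ^ n)) *
        ((v - u) / 2) ^ (-(k : ℤ) - 3 - n) := by
  induction n with
  | zero =>
    intro u hu
    rw [iteratedDeriv_zero, hF u hu]
    refine Finset.sum_congr rfl fun k _ => ?_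
    have : ((k + 2).factorial : ℝ) ≠ 0 := by positivity
    simp [this]
  | succ n ih =>
    intro u hu
    rw [iteratedDeriv_succ]
    have hev : iteratedDeriv n F =ᶠ[nhds u] _ := eventually_of_mem (Iio_mem_nhds hu) ih
    rw [hev.deriv_eq]
    refine (HasDerivAt.fun_sum fun (k : ℕ) _ =>
      (hasDerivAt_radius_zpow v (-(k : ℤ) - 3 - n) hu).const_mul _).deriv.trans ?_
    refine Finset.sum_congr rfl fun k _ => ?_
    have hexp : -(k : ℤ) - 3 - (n + 1 : ℕ) = -(k : ℤ) - 3 - n - 1 := by push_cast; ring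
    rw [hexp, ← add_assoc, Nat.factorial_succ (k + 2 + n), pow_succ]
    push_cast
    field_simp
    ring

/-- Binomial expansion of `u ^ ℓ * r ^ (-ℓ - 3)` in inverse powers of `r = (v - u) / 2`. -/
theorem pow_mul_radius_zpow_eq_sum (ℓ : ℕ) (v c : ℝ) {w : ℝ} (hw : w < v) :
    c * w ^ ℓ * ((v - w) / 2) ^ (-(ℓ : ℤ) - 3) = ∑ k ∈ Finset.range (ℓ + 1),
      (c * v ^ k * (-2) ^ (ℓ - k) * (ℓ.choose k : ℝ)) * ((v - w) / 2) ^ (-(k : ℤ) - 3) := by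
  have hr : (v - w) / 2 ≠ 0 := by linarith
  set r := (v - w) / 2 with hrdef
  have hwr : w = v + -2 * r := by rw [hrdef]; ring
  rw [hwr, add_pow, Finset.mul_sum, Finset.sum_mul]
  refine Finset.sum_congr rfl fun k hk => ?_
  have hk' : k ≤ ℓ := Nat.lt_succ_iff.mp (Finset.mem_range.mp hk)
  have hpow : r ^ (-(k : ℤ) - 3) = r ^ (ℓ - k) * r ^ (-(ℓ : ℤ) - 3) := by
    rw [← zpow_natCast r (ℓ - k), ← zpow_add₀ hr]
    congr 1
    omega
  rw [hpow, mul_pow]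
  ring

/-- Minkowskian multipole-wave profile along an ingoing cone `v = v*` with
`r = (v* − u)/2` and `ψ₀(u) = r^{ℓ−2}·∂_u^{ℓ−2}(f(u)·r^{−ℓ−3})`: for `f(u) = c₀·u^ℓ`,
`r³·ψ₀(u) → (−1)^ℓ·2·ℓ!·c₀` as `u → −∞`, so `Ψ₀` decays exactly like `r⁻³` towards
past null infinity. -/
theorem psi0_profile_rcubed_decay (ℓ : ℕ) (hℓ : 2 ≤ ℓ) (vstar : ℝ) (c₀ : ℝ) :
    Tendsto (fun u => ((vstar - u) / 2) ^ (3 : ℕ) * (((vstar - u) / 2) ^ ((ℓ : ℤ) - 2) *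
        iteratedDeriv (ℓ - 2)
          (fun w => c₀ * w ^ ℓ * ((vstar - w) / 2) ^ (-(ℓ : ℤ) - 3)) u)) atBot
      (nhds ((-1 : ℝ) ^ ℓ * 2 * (Nat.factorial ℓ : ℝ) * c₀)) := by
  have hr : Tendsto (fun u : ℝ => (vstar - u) / 2) atBot atTop :=
    (tendsto_atTop_add_const_left atBot vstar tendsto_neg_atBot_atTop).atTop_div_const two_pos
  have hterm (k : ℕ) : Tendsto (fun u : ℝ => ((vstar - u) / 2)⁻¹ ^ k) atBot (nhds (0 ^ k)) :=
    (tendsto_inv_atTop_zero.comp hr).pow k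
  have hlim := tendsto_finsetSum (Finset.range (ℓ + 1)) fun k _ =>
    (hterm k).const_mul ((c₀ * vstar ^ k * (-2) ^ (ℓ - k) * (ℓ.choose k : ℝ)) *
      (((k + 2 + (ℓ - 2)).factorial : ℝ) / ((k + 2).factorial * 2 ^ (ℓ - 2))))
  have hval : (-1 : ℝ) ^ ℓ * 2 * (Nat.factorial ℓ : ℝ) * c₀ =
      ∑ k ∈ Finset.range (ℓ + 1), (c₀ * vstar ^ k * (-2) ^ (ℓ - k) * (ℓ.choose k : ℝ)) *
        (((k + 2 + (ℓ - 2)).factorial : ℝ) / ((k + 2).factorial * 2 ^ (ℓ - 2))) * 0 ^ k := by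
    rw [Finset.sum_eq_single_of_mem 0 (by simp) fun k _ hk => by simp [hk]]
    obtain ⟨n, rfl⟩ := Nat.exists_eq_add_of_le hℓ
    have h2 : (-2 : ℝ) ^ (2 + n) = (-1) ^ (2 + n) * (4 * 2 ^ n) := by
      rw [neg_pow, pow_add 2]; norm_num
    simp only [Nat.sub_zero, Nat.add_sub_cancel_left, zero_add, h2]
    norm_num [Nat.factorial_two]
    field_simp
    ring
  rw [hval]
  refine hlim.congr' ?_
  filter_upwards [eventually_lt_atBot vstar] with u hu
  have hr0 : (vstar - u) / 2 ≠ 0 := by linarith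
  rw [iteratedDeriv_sum_radius_zpow vstar _ _ (ℓ + 1)
    (fun w hw => pow_mul_radius_zpow_eq_sum ℓ vstar c₀ hw) (ℓ - 2) u hu,
    Finset.mul_sum, Finset.mul_sum]
  refine Finset.sum_congr rfl fun k _ => ?_
  have hpow : ((vstar - u) / 2)⁻¹ ^ k = ((vstar - u) / 2) ^ (3 : ℕ) *
      (((vstar - u) / 2) ^ ((ℓ : ℤ) - 2) *
        ((vstar - u) / 2) ^ (-(k : ℤ) - 3 - (ℓ - 2 : ℕ))) := by
    rw [← zpow_natCast _ 3, ← zpow_add₀ hr0, ← zpow_add₀ hr0, inv_pow, ← zpow_natCast,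
      ← zpow_neg]
    congr 1
    omega
  rw [hpow]
  ring
end
end
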